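/- For all integers a ≥ 1 and b ≥ 1, there exist infinitely many natural numbers n such that a·s₂(n) = b·s₃(n); that is, for every N there exists n > N with a·s₂(n) = b·s₃(n). -/

import Mathlib

/-- Sum of digits of `n` in base `q`. -/
def digitSum (q n : ℕ) : ℕ := (Nat.digits q n).sum

theorem ds_zero (p : ℕ) : digitSum p 0 = 0 := by simp [digitSum]

theorem ds_rec {p : ℕ} (hp : 2 ≤ p) (n : ℕ) : digitSum p n = n % p + digitSum p (n / p) := by
  rcases Nat.eq_zero_or_pos n with h | h
  · subst h; simp [digitSum]
  · unfold digitSum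
    rw [Nat.digits_def' (by omega) h]; simp

theorem ds_lt {p : ℕ} (hp : 2 ≤ p) {n : ℕ} (hn : n < p) : digitSum p n = n := by
  rw [ds_rec hp, Nat.mod_eq_of_lt hn, Nat.div_eq_of_lt hn, ds_zero]; omega

theorem ds_cons {p : ℕ} (hp : 2 ≤ p) {u : ℕ} (hu : u < p) (w : ℕ) :
    digitSum p (u + p * w) = u + digitSum p w := by
  rw [ds_rec hp, Nat.add_mul_mod_self_left, Nat.mod_eq_of_lt hu,
    Nat.add_mul_div_left _ _ (by omega), Nat.div_eq_of_lt hu, zero_add]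

theorem ds_add {p : ℕ} (hp : 2 ≤ p) (K : ℕ) : ∀ {u : ℕ}, u < p ^ K → ∀ w,
    digitSum p (u + p ^ K * w) = digitSum p u + digitSum p w := by
  induction K with
  | zero => intro u hu w; simp at hu; subst hu; simp [ds_zero]
  | succ K ih =>
    intro u hu w
    have h1 : u = u % p + p * (u / p) := (Nat.mod_add_div u p).symm
    have h2 : u / p < p ^ K := by
      apply Nat.div_lt_of_lt_mul; rw [pow_succ] at hu; linarith
    have h3 : u % p < p := Nat.mod_lt _ (by omega)
    have h4 : u + p ^ (K + 1) * w = u % p + p * (u / p + p ^ K * w) := by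
      conv_lhs => rw [h1]
      ring
    rw [h4, ds_cons hp h3, ih h2, ds_rec hp u]; ring

theorem ds_split {p : ℕ} (hp : 2 ≤ p) (K n : ℕ) :
    digitSum p n = digitSum p (n % p ^ K) + digitSum p (n / p ^ K) := by
  conv_lhs => rw [← Nat.mod_add_div n (p ^ K)]
  exact ds_add hp K (Nat.mod_lt _ (by positivity)) _

theorem ds_le {p : ℕ} (hp : 2 ≤ p) (K : ℕ) : ∀ {u : ℕ}, u < p ^ K →
    digitSum p u ≤ (p - 1) * K := by
  induction K with
  | zero => intro u hu; simp at hu; subst hu; simp [ds_zero]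
  | succ K ih =>
    intro u hu
    have h2 : u / p < p ^ K := by
      apply Nat.div_lt_of_lt_mul; rw [pow_succ] at hu; linarith
    have h3 : u % p < p := Nat.mod_lt _ (by omega)
    rw [ds_rec hp]
    have := ih h2
    have : u % p ≤ p - 1 := by omega
    rw [mul_add]; omega

theorem ds_pow_mul {p : ℕ} (hp : 2 ≤ p) (K w : ℕ) :
    digitSum p (p ^ K * w) = digitSum p w := by
  have := ds_add hp K (u := 0) (by positivity) w
  simpa [ds_zero] using this

theorem ds_pow {p : ℕ} (hp : 2 ≤ p) (K : ℕ) : digitSum p (p ^ K) = 1 := by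
  have := ds_pow_mul hp K 1
  rw [ds_lt hp (show 1 < p by omega), mul_one] at this; exact this

theorem ds_pow_sub {p : ℕ} (hp : 2 ≤ p) (K : ℕ) : digitSum p (p ^ K - 1) = (p - 1) * K := by
  induction K with
  | zero => simp [ds_zero]
  | succ K ih =>
    have h : p ^ (K + 1) - 1 = (p - 1) + p * (p ^ K - 1) := by
      have : 1 ≤ p ^ K := Nat.one_le_pow _ _ (by omega)
      obtain ⟨c, hc⟩ := Nat.exists_eq_add_of_le this
      obtain ⟨d, hd⟩ := Nat.exists_eq_add_of_le hp
      rw [pow_succ, hc, hd]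
      have : (1 + c) * (2 + d) = 1 + ((2 + d - 1) + (2 + d) * (1 + c - 1)) := by
        have e1 : 2 + d - 1 = 1 + d := by omega
        have e2 : 1 + c - 1 = c := by omega
        rw [e1, e2]; ring
      omega
    rw [h, ds_cons hp (by omega), ih]; ring

theorem ds_pos {p : ℕ} (hp : 2 ≤ p) {n : ℕ} (hn : 1 ≤ n) : 1 ≤ digitSum p n := by
  induction n using Nat.strong_induction_on with
  | _ n ih =>
    rw [ds_rec hp]
    rcases Nat.lt_or_ge n p with h | h
    · rw [Nat.mod_eq_of_lt h]; omega
    · have := ih (n / p) (Nat.div_lt_self (by omega) (by omega)) (Nat.div_pos h (by omega))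
      omega

theorem ds_succ {p : ℕ} (hp : 2 ≤ p) (n : ℕ) : digitSum p (n + 1) ≤ digitSum p n + 1 := by
  induction n using Nat.strong_induction_on with
  | _ n ih =>
    have h1 : n = n % p + p * (n / p) := (Nat.mod_add_div n p).symm
    have h3 : n % p < p := Nat.mod_lt _ (by omega)
    rcases Nat.lt_or_ge (n % p + 1) p with h | h
    · have : n + 1 = (n % p + 1) + p * (n / p) := by omega
      rw [this, ds_cons hp h, ds_rec hp n]; omega
    · have h4 : n + 1 = 0 + p * (n / p + 1) := by
        rw [mul_add]; omega
      rw [h4, ds_cons hp (by omega), ds_rec hp n]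
      have h5 : n / p < n := Nat.div_lt_self (by
        rcases Nat.eq_zero_or_pos n with h | h
        · subst h; simp at *; omega
        · exact h) (by omega)
      have := ih _ h5
      omega

theorem ds_add_pow {p : ℕ} (hp : 2 ≤ p) (n K : ℕ) :
    digitSum p (n + p ^ K) ≤ digitSum p n + 1 := by
  have h1 : n + p ^ K = n % p ^ K + p ^ K * (n / p ^ K + 1) := by
    conv_lhs => rw [← Nat.mod_add_div n (p ^ K)]
    ring
  rw [h1, ds_add hp K (Nat.mod_lt _ (by positivity)), ds_split hp K n]
  have := ds_succ hp (n / p ^ K); omega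

theorem ds_div_le {p : ℕ} (hp : 2 ≤ p) (n K : ℕ) : digitSum p (n / p ^ K) ≤ digitSum p n := by
  rw [ds_split hp K n]; omega

theorem ds_three_mod (n : ℕ) : digitSum 3 n % 2 = n % 2 := by
  have := Nat.modEq_digits_sum 2 3 (by norm_num) n
  exact this.symm

def ff (p q a b n : ℕ) : ℤ := (a : ℤ) * digitSum p n - b * digitSum q n

def Gad (p q a b : ℕ) : Prop := ∃ g : ℕ, 1 ≤ g ∧ ∀ η : ℕ, ∃ n0 : ℕ, ∀ n ≥ n0, ∃ K L x y : ℕ,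
  η * (K + L) ≤ 4 ^ n ∧ x < p ^ K ∧ y < q ^ L ∧
  ∀ N, N % p ^ K = x → N % q ^ L = y → (g : ℤ) ∣ ff p q a b N ∧
    ∀ r : ℕ, r < 2 ^ n → ∃ τ, ff p q a b (N + τ) = ff p q a b N + g * r

theorem pad {p : ℕ} (hp : 2 ≤ p) (h : ℕ) : ∀ M, 1 ≤ M → M < p ^ (h + 1) → ∀ c, 1 ≤ c →
    ∃ X, X + M < p ^ (h + c + 1) ∧ digitSum p (X + M) + (p - 1) * c = digitSum p X + digitSum p M := by
  induction h with
  | zero =>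
    intro M hM hM2 c hc
    obtain ⟨c, rfl⟩ : ∃ d, c = d + 1 := ⟨c - 1, by omega⟩
    simp at hM2
    have h1 : 1 ≤ p ^ c := Nat.one_le_pow _ _ (by omega)
    have h2 : (p - M) + p * (p ^ c - 1) + M = p ^ (c + 1) := by
      rw [Nat.mul_sub, pow_succ, mul_comm (p ^ c) p, mul_one]
      have : p ≤ p * p ^ c := Nat.le_mul_of_pos_right _ h1
      omega
    refine ⟨(p - M) + p * (p ^ c - 1), ?_, ?_⟩
    · rw [h2]; apply Nat.pow_lt_pow_right (by omega) (by omega)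
    · rw [h2, ds_pow hp, ds_cons hp (by omega), ds_pow_sub hp, ds_lt hp hM2, mul_add]; omega
  | succ h ih =>
    intro M hM hM2 c hc
    rcases Nat.lt_or_ge M p with hlt | hge
    · have hM3 : M < p ^ (h + 1) := lt_of_lt_of_le hlt (Nat.le_self_pow (by omega) p)
      obtain ⟨X, h1, h2⟩ := ih M hM hM3 c hc
      exact ⟨X, lt_of_lt_of_le h1 (Nat.pow_le_pow_right (by omega) (by omega)), h2⟩
    · have h3 : M / p < p ^ (h + 1) := by
        apply Nat.div_lt_of_lt_mul; rw [pow_succ] at hM2; linarith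
      obtain ⟨X, h1, h2⟩ := ih (M / p) (Nat.div_pos hge (by omega)) h3 c hc
      have h4 : M % p < p := Nat.mod_lt _ (by omega)
      have h5 : p * X + M = M % p + p * (X + M / p) := by
        rw [mul_add]; have := Nat.mod_add_div M p; omega
      refine ⟨p * X, ?_, ?_⟩
      · rw [h5]
        have : p ^ (h + 1 + c + 1) = p * p ^ (h + c + 1) := by rw [← pow_succ']; congr 1; omega
        rw [this]
        have : p * (X + M / p) + p ≤ p * p ^ (h + c + 1) := by
          rw [← Nat.mul_succ]; exact Nat.mul_le_mul_left _ h1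
        omega
      · have h6 := ds_cons hp (show 0 < p by omega) X
        rw [h5, ds_cons hp h4, ds_rec hp M]
        simp only [zero_add] at h6
        rw [h6]; omega

theorem digit_lt {A B u z : ℕ} (hu : u < A) (hz : z < B) : u + A * z < A * B := by
  have h : A * (z + 1) ≤ A * B := Nat.mul_le_mul_left A hz
  rw [mul_add] at h; omega


set_option maxHeartbeats 1000000 in
theorem gad_fin (a b A1 B1 : ℕ) (e : ℤ) (he : 2 * (b : ℤ) * B1 - a * A1 = e) : ∀ n : ℕ,
    ∃ K L x y : ℕ, ∃ τ : ℕ → ℕ, 1 ≤ K ∧ 1 ≤ L ∧ x % 2 = 0 ∧ τ 0 = 0 ∧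
      (5 * K + 7 * L : ℝ) ≤ (12 + 24 * (5 * A1 + 7 * B1)) * (39 / 10) ^ n ∧
      ∀ r < 2 ^ n, x + τ r < 2 ^ K ∧ y + τ r < 3 ^ L ∧
        (a : ℤ) * digitSum 2 (x + τ r) - b * digitSum 3 (y + τ r) =
          a * digitSum 2 x - b * digitSum 3 y + e * r := by
  intro n
  induction n with
  | zero =>
    refine ⟨1, 1, 0, 0, fun _ => 0, le_refl _, le_refl _, rfl, rfl, ?_, ?_⟩
    · have : (0:ℝ) ≤ A1 := by positivity
      have : (0:ℝ) ≤ B1 := by positivity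
      norm_num; linarith
    · intro r hr
      have : r = 0 := by simpa using hr
      subst this; simp
  | succ n ih =>
    obtain ⟨K, L, x, y, τ, hK, hL, hx, h0, hu, hr⟩ := ih
    set W := 2 ^ n with hW
    -- base 2
    have hm2 : 3 ^ L < 2 ^ (2 * L - 1 + 1) := by
      have : 2 * L - 1 + 1 = 2 * L := by omega
      rw [this, pow_mul]; exact Nat.pow_lt_pow_left (by norm_num) (by omega)
    have hs2 : 1 ≤ digitSum 2 (3 ^ L) := ds_pos (le_refl _) (Nat.one_le_pow _ _ (by norm_num))
    obtain ⟨X, hX1, hX2⟩ := pad (le_refl 2) (2 * L - 1) (3 ^ L) (Nat.one_le_pow _ _ (by norm_num)) hm2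
      (digitSum 2 (3 ^ L) + W * A1) (by omega)
    have hm3 : 2 ^ K < 3 ^ (K - 1 + 1) := by
      have : K - 1 + 1 = K := by omega
      rw [this]; exact Nat.pow_lt_pow_left (by norm_num) (by omega)
    have hs3 : 1 ≤ digitSum 3 (2 ^ K) := ds_pos (by norm_num) (Nat.one_le_pow _ _ (by norm_num))
    have hpar : digitSum 3 (2 ^ K) % 2 = 0 := by
      rw [ds_three_mod, Nat.pow_mod]; simp [show K ≠ 0 by omega]
    obtain ⟨c3, hc3⟩ : ∃ c3, digitSum 3 (2 ^ K) = 2 * c3 := ⟨digitSum 3 (2 ^ K) / 2, by omega⟩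
    obtain ⟨Y, hY1, hY2⟩ := pad (show 2 ≤ 3 by norm_num) (K - 1) (2 ^ K) (Nat.one_le_pow _ _ (by norm_num)) hm3
      (c3 + W * B1) (by omega)
    have hs2' := ds_le (le_refl 2) _ hm2
    have hs3' := ds_le (show 2 ≤ 3 by norm_num) _ hm3
    set c2 := digitSum 2 (3 ^ L) with hc2
    have key : (a : ℤ) * (digitSum 2 (X + 3 ^ L) - digitSum 2 X)
        - b * (digitSum 3 (Y + 2 ^ K) - digitSum 3 Y) = e * W := by
      have e1 : (digitSum 2 (X + 3 ^ L) : ℤ) - digitSum 2 X = - (W * A1 : ℤ) := by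
        push_cast [← @Nat.cast_inj ℤ] at hX2 ⊢; simp at hX2; push_cast at *; linarith
      have e2 : (digitSum 3 (Y + 2 ^ K) : ℤ) - digitSum 3 Y = - (2 * (W * B1) : ℤ) := by
        rw [hc3] at hY2
        have : digitSum 3 (Y + 2 ^ K) + 2 * (W * B1) = digitSum 3 Y := by omega
        have := congrArg (Nat.cast : ℕ → ℤ) this
        push_cast at this ⊢; linarith
      rw [e1, e2, ← he]; ring
    set k2 := 2 * L - 1 + (c2 + W * A1) + 1 with hk2
    set k3 := K - 1 + (c3 + W * B1) + 1 with hk3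
    have step2 : ∀ (u z : ℕ), u < 2 ^ K → z < 2 ^ k2 → u + 2 ^ K * z < 2 ^ (K + k2) := by
      intro u z hu hz
      rw [pow_add]; exact digit_lt hu hz
    have step3 : ∀ (u z : ℕ), u < 3 ^ L → z < 3 ^ k3 → u + 3 ^ L * z < 3 ^ (L + k3) := by
      intro u z hu hz
      rw [pow_add]; exact digit_lt hu hz
    have hr0 := hr 0 (by positivity)
    rw [h0] at hr0
    simp only [add_zero] at hr0
    have hWpos : 0 < W := by positivity
    refine ⟨K + k2, L + k3, x + 2 ^ K * X, y + 3 ^ L * Y,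
      fun r => if r < W then τ r else τ (r - W) + 2 ^ K * 3 ^ L, by omega, by omega, ?_, ?_, ?_, ?_⟩
    · have : 2 ^ K = 2 * 2 ^ (K - 1) := by rw [← pow_succ']; congr 1; omega
      rw [this]
      rw [mul_assoc]; omega
    · simp [hWpos, h0]
    · have b1 : K + k2 ≤ K + 4 * L + W * A1 := by omega
      have b2 : L + k3 ≤ L + 2 * K + W * B1 := by omega
      have b1' : ((K + k2 : ℕ) : ℝ) ≤ K + 4 * L + W * A1 := by exact_mod_cast b1
      have b2' : ((L + k3 : ℕ) : ℝ) ≤ L + 2 * K + W * B1 := by exact_mod_cast b2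
      have hWr : (W : ℝ) ≤ (39 / 10) ^ n := by
        rw [hW]; push_cast; exact pow_le_pow_left₀ (by norm_num) (by norm_num) n
      have hA : (0:ℝ) ≤ A1 := by positivity
      have hB : (0:ℝ) ≤ B1 := by positivity
      have hKr : (0:ℝ) ≤ K := by positivity
      have h1 := mul_le_mul_of_nonneg_right hWr (show (0:ℝ) ≤ 5 * A1 + 7 * B1 by positivity)
      have hl : (1:ℝ) ≤ (39 / 10) ^ n := one_le_pow₀ (by norm_num)
      rw [pow_succ]
      set Λ : ℝ := (39 / 10) ^ n
      have h2 : 0 ≤ (5 * (A1:ℝ) + 7 * B1) * Λ := by positivity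
      nlinarith
    · intro r hr'
      by_cases hlt : r < W
      · simp only [hlt, if_true]
        obtain ⟨g1, g2, g3⟩ := hr r hlt
        have e1 : x + 2 ^ K * X + τ r = (x + τ r) + 2 ^ K * X := by ring
        have e2 : y + 3 ^ L * Y + τ r = (y + τ r) + 3 ^ L * Y := by ring
        refine ⟨?_, ?_, ?_⟩
        · rw [e1]; exact step2 _ _ g1 (by omega)
        · rw [e2]; exact step3 _ _ g2 (by omega)
        · rw [e1, e2, ds_add (le_refl 2) K g1, ds_add (by norm_num) L g2,
            ds_add (le_refl 2) K hr0.1, ds_add (by norm_num) L hr0.2.1]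
          push_cast; linarith
      · simp only [hlt, if_false]
        have hr2 : r - W < W := by rw [pow_succ] at hr'; omega
        obtain ⟨g1, g2, g3⟩ := hr (r - W) hr2
        have e1 : x + 2 ^ K * X + (τ (r - W) + 2 ^ K * 3 ^ L) = (x + τ (r - W)) + 2 ^ K * (X + 3 ^ L) := by ring
        have e2 : y + 3 ^ L * Y + (τ (r - W) + 2 ^ K * 3 ^ L) = (y + τ (r - W)) + 3 ^ L * (Y + 2 ^ K) := by ring
        refine ⟨?_, ?_, ?_⟩
        · rw [e1]; exact step2 _ _ g1 (by omega)
        · rw [e2]; exact step3 _ _ g2 (by omega)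
        · rw [e1, e2, ds_add (le_refl 2) K g1, ds_add (by norm_num) L g2,
            ds_add (le_refl 2) K hr0.1, ds_add (by norm_num) L hr0.2.1]
          have : (r : ℤ) = ((r - W : ℕ) : ℤ) + W := by omega
          rw [this]
          push_cast at g3 ⊢; linarith

theorem bez (a c : ℕ) (ha : 1 ≤ a) (hc : 1 ≤ c) :
    ∃ A B : ℕ, (c : ℤ) * B - a * A = Nat.gcd a c := by
  have h := Nat.gcd_eq_gcd_ab a c
  set x := Nat.gcdA a c
  set y := Nat.gcdB a c
  set t := |x| + |y|
  have hx := neg_abs_le x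
  have hx2 := le_abs_self x
  have hy := neg_abs_le y
  have ha' : (1:ℤ) ≤ a := by exact_mod_cast ha
  have hc' : (1:ℤ) ≤ c := by exact_mod_cast hc
  have p1 := abs_nonneg x
  have p2 := abs_nonneg y
  obtain ⟨A, hA⟩ := Int.eq_ofNat_of_zero_le (show 0 ≤ -x + c * t by nlinarith)
  obtain ⟨B, hB⟩ := Int.eq_ofNat_of_zero_le (show 0 ≤ y + a * t by nlinarith)
  refine ⟨A, B, ?_⟩
  have hA' : (A : ℤ) = -x + c * t := by rw [hA]
  have hB' : (B : ℤ) = y + a * t := by rw [hB]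
  rw [hA', hB', h]; ring

theorem gad_gen (a b : ℕ) (ha : 1 ≤ a) (hb : 1 ≤ b) (A1 B1 : ℕ) (e : ℤ)
    (he : 2 * (b : ℤ) * B1 - a * A1 = e) (η : ℕ) : ∃ n0 : ℕ, ∀ n ≥ n0, ∃ K L x y : ℕ,
  η * (K + L) ≤ 4 ^ n ∧ x < 2 ^ K ∧ y < 3 ^ L ∧
  ∀ N, N % 2 ^ K = x → N % 3 ^ L = y → (Nat.gcd a (2 * b) : ℤ) ∣ ff 2 3 a b N ∧
    ∀ r : ℕ, r < 2 ^ n → ∃ τ, ff 2 3 a b (N + τ) = ff 2 3 a b N + e * r := by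
  set C : ℝ := 12 + 24 * (5 * A1 + 7 * B1) with hC
  have hCpos : 0 < C := by positivity
  obtain ⟨n0, hn0⟩ := exists_pow_lt_of_lt_one (show (0:ℝ) < 1 / (η * C + 1) by positivity)
    (show (39 / 40 : ℝ) < 1 by norm_num)
  refine ⟨n0, fun n hn => ?_⟩
  obtain ⟨K, L, x, y, τ, hK, hL, hx, h0, hu, hr⟩ := gad_fin a b A1 B1 e he n
  have hr0 := hr 0 (by positivity)
  rw [h0] at hr0
  simp only [add_zero] at hr0
  refine ⟨K, L, x, y, ?_, hr0.1, hr0.2.1, ?_⟩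
  · have h1 : (39 / 40 : ℝ) ^ n ≤ (39 / 40) ^ n0 := pow_le_pow_of_le_one (by norm_num) (by norm_num) hn
    have h2 : (39 / 40 : ℝ) ^ n * (η * C + 1) ≤ 1 := by
      have := h1.trans hn0.le
      rwa [le_div_iff₀ (by positivity)] at this
    have h3 : (39 / 10 : ℝ) ^ n = (39 / 40) ^ n * 4 ^ n := by rw [← mul_pow]; norm_num
    have h4 : (η : ℝ) * (K + L) ≤ 4 ^ n := by
      calc (η : ℝ) * (K + L) ≤ η * (5 * K + 7 * L) := by
            apply mul_le_mul_of_nonneg_left _ (by positivity)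
            have : (0:ℝ) ≤ K := by positivity
            have : (0:ℝ) ≤ L := by positivity
            linarith
        _ ≤ η * (C * (39 / 10) ^ n) := mul_le_mul_of_nonneg_left hu (by positivity)
        _ = ((39 / 40) ^ n * (η * C)) * 4 ^ n := by rw [h3]; ring
        _ ≤ 1 * 4 ^ n := by
            apply mul_le_mul_of_nonneg_right _ (by positivity)
            have : (0:ℝ) ≤ (39 / 40) ^ n := by positivity
            linarith
        _ = 4 ^ n := one_mul _
    exact_mod_cast h4
  · intro N hNx hNy
    constructor
    · have hev : N % 2 = 0 := by
        have : N % 2 ^ K % 2 = N % 2 := Nat.mod_mod_of_dvd _ (dvd_pow_self 2 (by omega))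
        rw [hNx] at this; omega
      have h3 := ds_three_mod N
      obtain ⟨c, hc⟩ : ∃ c, digitSum 3 N = 2 * c := ⟨digitSum 3 N / 2, by omega⟩
      unfold ff
      rw [hc]
      apply dvd_sub
      · exact Dvd.dvd.mul_right (by exact_mod_cast Nat.gcd_dvd_left a (2 * b)) _
      · have : ((b : ℤ) * ((2 * c : ℕ) : ℤ)) = ((2 * b : ℕ) : ℤ) * c := by push_cast; ring
        rw [this]
        exact Dvd.dvd.mul_right (by exact_mod_cast Nat.gcd_dvd_right a (2 * b)) _
    · intro r hr'
      refine ⟨τ r, ?_⟩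
      obtain ⟨g1, g2, g3⟩ := hr r hr'
      have e1 : N + τ r = (x + τ r) + 2 ^ K * (N / 2 ^ K) := by
        have := Nat.mod_add_div N (2 ^ K); omega
      have e2 : N + τ r = (y + τ r) + 3 ^ L * (N / 3 ^ L) := by
        have := Nat.mod_add_div N (3 ^ L); omega
      have f1 : digitSum 2 (N + τ r) = digitSum 2 (x + τ r) + digitSum 2 (N / 2 ^ K) := by
        rw [e1]; exact ds_add (le_refl 2) K g1 _
      have f2 : digitSum 3 (N + τ r) = digitSum 3 (y + τ r) + digitSum 3 (N / 3 ^ L) := by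
        rw [e2]; exact ds_add (by norm_num) L g2 _
      have f3 := ds_split (le_refl 2) K N
      have f4 := ds_split (show 2 ≤ 3 by norm_num) L N
      rw [hNx] at f3
      rw [hNy] at f4
      unfold ff
      rw [f1, f2, f3, f4]; push_cast; linarith

theorem gad23 (a b : ℕ) (ha : 1 ≤ a) (hb : 1 ≤ b) : Gad 2 3 a b := by
  obtain ⟨A, B, h⟩ := bez a (2 * b) ha (by omega)
  refine ⟨Nat.gcd a (2 * b), Nat.gcd_pos_of_pos_left _ (by omega), fun η => ?_⟩
  exact gad_gen a b ha hb A B _ (by rw [← h]; push_cast; ring) η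

theorem gad32 (a b : ℕ) (ha : 1 ≤ a) (hb : 1 ≤ b) : Gad 3 2 b a := by
  obtain ⟨B, A, h⟩ := bez (2 * b) a (by omega) ha
  refine ⟨Nat.gcd a (2 * b), Nat.gcd_pos_of_pos_left _ (by omega), fun η => ?_⟩
  have he : 2 * (b : ℤ) * B - a * A = - (Nat.gcd a (2 * b) : ℤ) := by
    rw [Nat.gcd_comm, ← h]; push_cast; ring
  obtain ⟨n0, hn0⟩ := gad_gen a b ha hb A B _ he η
  refine ⟨n0, fun n hn => ?_⟩
  obtain ⟨K, L, x, y, h1, h2, h3, h4⟩ := hn0 n hn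
  refine ⟨L, K, y, x, by rw [add_comm]; exact h1, h3, h2, fun N hN1 hN2 => ?_⟩
  obtain ⟨h5, h6⟩ := h4 N hN2 hN1
  have sw : ∀ n, ff 3 2 b a n = - ff 2 3 a b n := fun n => by unfold ff; ring
  refine ⟨by rw [sw]; exact (dvd_neg).2 h5, fun r hr => ?_⟩
  obtain ⟨τ, hτ⟩ := h6 r hr
  exact ⟨τ, by rw [sw, sw, hτ]; ring⟩


theorem count_le {D B : ℕ} (hD : 1 ≤ D) (S : Finset ℕ) (hS : S ⊆ Finset.range B)
    (hc : ∀ x ∈ S, ∀ y ∈ S, x ≡ y [MOD D]) : D * S.card ≤ B + D := by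
  rcases S.eq_empty_or_nonempty with h | ⟨c, hcS⟩
  · subst h; simp
  · have h1 : S ⊆ (Finset.range B).filter (fun x => x ≡ c [MOD D]) := by
      intro x hx
      exact Finset.mem_filter.2 ⟨hS hx, hc x hx c hcS⟩
    have h2 := Finset.card_le_card h1
    rw [← Nat.count_eq_card_filter_range, Nat.count_modEq_card _ (by omega)] at h2
    have h3 : S.card ≤ B / D + 1 := h2.trans (by split_ifs <;> omega)
    calc D * S.card ≤ D * (B / D + 1) := Nat.mul_le_mul_left _ h3
      _ = D * (B / D) + D := by ring
      _ ≤ B + D := by have := Nat.mul_div_le B D; omega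

theorem sum_range_mul_split (A B : ℕ) (f : ℕ → ℤ) :
    ∑ v ∈ Finset.range (A * B), f v = ∑ w ∈ Finset.range B, ∑ u ∈ Finset.range A, f (u + A * w) := by
  induction B with
  | zero => simp
  | succ B ih =>
    rw [Nat.mul_succ, Finset.sum_range_add, ih, Finset.sum_range_succ]
    congr 1
    exact Finset.sum_congr rfl fun u _ => by rw [add_comm]

def AA (q m v : ℕ) : ℤ := 2 * digitSum q v - (q - 1) * m

theorem AA_add {q : ℕ} (hq : 2 ≤ q) (m1 m2 : ℕ) {u : ℕ} (hu : u < q ^ m1) (w : ℕ) :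
    AA q (m1 + m2) (u + q ^ m1 * w) = AA q m1 u + AA q m2 w := by
  unfold AA; rw [ds_add hq m1 hu]; push_cast; ring

theorem AA_one_sum {q : ℕ} (hq : 2 ≤ q) : ∑ u ∈ Finset.range q, AA q 1 u = 0 := by
  have h1 : ∀ u ∈ Finset.range q, AA q 1 u = 2 * (u : ℤ) - (q - 1) := by
    intro u hu
    unfold AA; rw [ds_lt hq (Finset.mem_range.1 hu)]; push_cast; ring
  rw [Finset.sum_congr rfl h1]
  have : ∀ n : ℕ, ∑ u ∈ Finset.range n, (2 * (u : ℤ)) = n * (n - 1) := by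
    intro n
    induction n with
    | zero => simp
    | succ n ih => rw [Finset.sum_range_succ, ih]; push_cast; ring
  rw [Finset.sum_sub_distrib, this]; simp; ring

theorem AA_sum {q : ℕ} (hq : 2 ≤ q) (m : ℕ) : ∑ v ∈ Finset.range (q ^ m), AA q m v = 0 := by
  induction m with
  | zero => simp [AA, ds_zero]
  | succ m ih =>
    rw [pow_succ, mul_comm, sum_range_mul_split]
    have : ∀ w ∈ Finset.range (q ^ m), ∑ u ∈ Finset.range q, AA q (m + 1) (u + q * w) = q * AA q m w := by
      intro w _
      have : ∀ u ∈ Finset.range q, AA q (m + 1) (u + q * w) = AA q 1 u + AA q m w := by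
        intro u hu
        have := AA_add hq 1 m (u := u) (by simpa using hu) w
        rw [add_comm m 1]; simpa using this
      rw [Finset.sum_congr rfl this, Finset.sum_add_distrib, AA_one_sum hq]; simp
    rw [Finset.sum_congr rfl this, ← Finset.mul_sum, ih, mul_zero]

theorem AA_sq {q : ℕ} (hq : 2 ≤ q) (m : ℕ) :
    ∑ v ∈ Finset.range (q ^ m), (AA q m v) ^ 2 ≤ m * q ^ 2 * q ^ m := by
  induction m with
  | zero => simp [AA, ds_zero]
  | succ m ih =>
    rw [pow_succ, mul_comm (q ^ m), sum_range_mul_split]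
    have h1 : ∀ w ∈ Finset.range (q ^ m), ∑ u ∈ Finset.range q, (AA q (m + 1) (u + q * w)) ^ 2
        ≤ q * (AA q m w) ^ 2 + q * q ^ 2 := by
      intro w _
      have : ∀ u ∈ Finset.range q, (AA q (m + 1) (u + q * w)) ^ 2
          = (AA q 1 u) ^ 2 + 2 * AA q m w * AA q 1 u + (AA q m w) ^ 2 := by
        intro u hu
        have := AA_add hq 1 m (u := u) (by simpa using hu) w
        rw [add_comm m 1]
        rw [pow_one] at this
        rw [this]; ring
      rw [Finset.sum_congr rfl this, Finset.sum_add_distrib, Finset.sum_add_distrib, ← Finset.mul_sum,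
        AA_one_sum hq]
      have h2 : ∑ u ∈ Finset.range q, (AA q 1 u) ^ 2 ≤ ∑ u ∈ Finset.range q, (q : ℤ) ^ 2 := by
        apply Finset.sum_le_sum
        intro u hu
        have hu' := Finset.mem_range.1 hu
        unfold AA
        rw [ds_lt hq hu']
        have : (u : ℤ) + 1 ≤ q := by exact_mod_cast hu'
        have h0 : (0 : ℤ) ≤ u := by positivity
        apply sq_le_sq'
        · push_cast; linarith
        · push_cast; linarith
      simp at h2 ⊢
      linarith
    refine (Finset.sum_le_sum h1).trans ?_
    rw [Finset.sum_add_distrib, ← Finset.mul_sum]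
    simp only [Finset.sum_const, Finset.card_range, nsmul_eq_mul]
    have : (0:ℤ) ≤ q := by positivity
    have := mul_le_mul_of_nonneg_left ih this
    push_cast
    rw [pow_succ (q : ℤ) m]
    linarith

theorem lemD {q : ℕ} (hq : 2 ≤ q) {D : ℕ} (hD : 1 ≤ D) (hcop : Nat.Coprime D q) (m1 m2 : ℕ)
    (h1 : D ≤ q ^ m1) (h2 : D ≤ q ^ m2) (c : ℕ) :
    (D : ℤ) * ∑ v ∈ (Finset.range (q ^ (m1 + m2))).filter (fun v => v ≡ c [MOD D]),
      (AA q (m1 + m2) v) ^ 2 ≤ 4 * q ^ 2 * ((m1 + m2 : ℕ) : ℤ) * q ^ (m1 + m2) := by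
  rw [Finset.sum_filter, pow_add, sum_range_mul_split]
  set R1 := Finset.range (q ^ m1)
  set R2 := Finset.range (q ^ m2)
  have hb : ∑ w ∈ R2, ∑ u ∈ R1, (if u + q ^ m1 * w ≡ c [MOD D] then
      (AA q (m1 + m2) (u + q ^ m1 * w)) ^ 2 else 0) ≤
      ∑ w ∈ R2, ∑ u ∈ R1, (2 * ((AA q m1 u) ^ 2 * if u + q ^ m1 * w ≡ c [MOD D] then 1 else 0)
        + 2 * ((AA q m2 w) ^ 2 * if u + q ^ m1 * w ≡ c [MOD D] then 1 else 0)) := by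
    apply Finset.sum_le_sum; intro w _
    apply Finset.sum_le_sum; intro u hu
    rw [AA_add hq m1 m2 (Finset.mem_range.1 hu)]
    split_ifs
    · nlinarith [sq_nonneg (AA q m1 u - AA q m2 w)]
    · simp
  have hsplit : ∑ w ∈ R2, ∑ u ∈ R1, (2 * ((AA q m1 u) ^ 2 * if u + q ^ m1 * w ≡ c [MOD D] then 1 else 0)
        + 2 * ((AA q m2 w) ^ 2 * if u + q ^ m1 * w ≡ c [MOD D] then 1 else 0))
      = 2 * ∑ u ∈ R1, (AA q m1 u) ^ 2 * (R2.filter (fun w => u + q ^ m1 * w ≡ c [MOD D])).card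
        + 2 * ∑ w ∈ R2, (AA q m2 w) ^ 2 * (R1.filter (fun u => u + q ^ m1 * w ≡ c [MOD D])).card := by
    simp_rw [Finset.sum_add_distrib, ← Finset.mul_sum]
    congr 1
    · congr 1
      rw [Finset.sum_comm]
      refine Finset.sum_congr rfl fun u _ => ?_
      rw [← Finset.mul_sum, Finset.sum_boole]
    · congr 1
      refine Finset.sum_congr rfl fun u _ => ?_
      rw [Finset.sum_boole]
  have c1 : ∀ u, (D : ℤ) * (R2.filter (fun w => u + q ^ m1 * w ≡ c [MOD D])).card ≤ 2 * q ^ m2 := by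
    intro u
    have := count_le hD (R2.filter (fun w => u + q ^ m1 * w ≡ c [MOD D])) (B := q ^ m2)
      (Finset.filter_subset _ _) (by
        intro x hx y hy
        have hx := (Finset.mem_filter.1 hx).2
        have hy := (Finset.mem_filter.1 hy).2
        have h := Nat.ModEq.add_left_cancel' u (hx.trans hy.symm)
        exact Nat.ModEq.cancel_left_of_coprime (hcop.pow_right m1) h)
    have h3 : D * (R2.filter (fun w => u + q ^ m1 * w ≡ c [MOD D])).card ≤ 2 * q ^ m2 := by omega
    exact_mod_cast h3
  have c2 : ∀ w, (D : ℤ) * (R1.filter (fun u => u + q ^ m1 * w ≡ c [MOD D])).card ≤ 2 * q ^ m1 := by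
    intro w
    have := count_le hD (R1.filter (fun u => u + q ^ m1 * w ≡ c [MOD D])) (B := q ^ m1)
      (Finset.filter_subset _ _) (by
        intro x hx y hy
        have hx := (Finset.mem_filter.1 hx).2
        have hy := (Finset.mem_filter.1 hy).2
        exact Nat.ModEq.add_right_cancel' _ (hx.trans hy.symm))
    have h3 : D * (R1.filter (fun u => u + q ^ m1 * w ≡ c [MOD D])).card ≤ 2 * q ^ m1 := by omega
    exact_mod_cast h3
  have d1 : (D : ℤ) * ∑ u ∈ R1, (AA q m1 u) ^ 2 * (R2.filter (fun w => u + q ^ m1 * w ≡ c [MOD D])).card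
      ≤ (m1 * q ^ 2 * q ^ m1) * (2 * q ^ m2) := by
    refine le_trans ?_ (mul_le_mul_of_nonneg_right (AA_sq hq m1) (by positivity))
    rw [Finset.mul_sum, Finset.sum_mul]
    apply Finset.sum_le_sum; intro u _
    have := mul_le_mul_of_nonneg_left (c1 u) (sq_nonneg (AA q m1 u))
    linarith
  have d2 : (D : ℤ) * ∑ w ∈ R2, (AA q m2 w) ^ 2 * (R1.filter (fun u => u + q ^ m1 * w ≡ c [MOD D])).card
      ≤ (m2 * q ^ 2 * q ^ m2) * (2 * q ^ m1) := by
    refine le_trans ?_ (mul_le_mul_of_nonneg_right (AA_sq hq m2) (by positivity))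
    rw [Finset.mul_sum, Finset.sum_mul]
    apply Finset.sum_le_sum; intro u _
    have := mul_le_mul_of_nonneg_left (c2 u) (sq_nonneg (AA q m2 u))
    linarith
  have := mul_le_mul_of_nonneg_left (hb.trans_eq hsplit) (show (0:ℤ) ≤ D by positivity)
  refine this.trans ?_
  rw [pow_add]
  push_cast
  nlinarith

theorem lemD' {q : ℕ} (hq : 2 ≤ q) {D : ℕ} (hD : 1 ≤ D) (hcop : Nat.Coprime D q) (m m1 : ℕ)
    (h0 : 2 * m1 ≤ m) (h1 : D ≤ q ^ m1) (v0 J : ℕ) (hJ : ∀ j < J, v0 + D * j < q ^ m) :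
    (D : ℤ) * ∑ j ∈ Finset.range J, (AA q m (v0 + D * j)) ^ 2 ≤ 4 * q ^ 2 * m * q ^ m := by
  have h2 : D ≤ q ^ (m - m1) := h1.trans (Nat.pow_le_pow_right (by omega) (by omega))
  have := lemD hq hD hcop m1 (m - m1) h1 h2 v0
  rw [show m1 + (m - m1) = m by omega] at this
  refine le_trans ?_ this
  apply mul_le_mul_of_nonneg_left _ (by positivity)
  have himg : ∑ j ∈ Finset.range J, (AA q m (v0 + D * j)) ^ 2
      = ∑ v ∈ (Finset.range J).image (fun j => v0 + D * j), (AA q m v) ^ 2 := by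
    rw [Finset.sum_image]
    intro x _ y _ hxy
    have : D * x = D * y := by simpa using hxy
    exact Nat.eq_of_mul_eq_mul_left (by omega) this
  rw [himg]
  apply Finset.sum_le_sum_of_subset_of_nonneg
  · intro v hv
    obtain ⟨j, hj, rfl⟩ := Finset.mem_image.1 hv
    refine Finset.mem_filter.2 ⟨Finset.mem_range.2 (hJ j (Finset.mem_range.1 hj)), ?_⟩
    simp [Nat.ModEq]
  · intros; positivity


theorem two_avg {p q : ℕ} (hp : 2 ≤ p) (hq : 2 ≤ q) (hcop : Nat.Coprime p q) (κ l Kp L m1 m1' u0 v0 J : ℕ)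
    (hk : p ^ κ ≤ q ^ (l + 3)) (hL : L ≤ l) (hKp : Kp ≤ κ)
    (hMod : p ^ Kp * q ^ L ≤ q ^ l) (hJ : J = q ^ l / (p ^ Kp * q ^ L))
    (hm1 : 2 * m1 ≤ l - L) (hm1p : p ^ Kp ≤ q ^ m1) (hm2 : 2 * m1' ≤ κ - Kp) (hm2p : q ^ L ≤ p ^ m1')
    (hv : ∀ j < J, v0 + p ^ Kp * j < q ^ (l - L)) (hu : ∀ j < J, u0 + q ^ L * j < p ^ (κ - Kp)) :
    ∃ j < J, (AA p (κ - Kp) (u0 + q ^ L * j)) ^ 2 + (AA q (l - L) (v0 + p ^ Kp * j)) ^ 2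
      ≤ 8 * p ^ 2 * q ^ 3 * κ + 8 * q ^ 2 * l := by
  set B : ℤ := 8 * p ^ 2 * q ^ 3 * κ + 8 * q ^ 2 * l with hB
  by_contra hcon
  push Not at hcon
  have hP : 1 ≤ p ^ Kp := Nat.one_le_pow _ _ (by omega)
  have hQ : 1 ≤ q ^ L := Nat.one_le_pow _ _ (by omega)
  have e1 := lemD' hq hP (hcop.pow_left Kp) (l - L) m1 hm1 hm1p v0 J hv
  have e2 := lemD' hp hQ (hcop.symm.pow_left L) (κ - Kp) m1' hm2 hm2p u0 J hu
  set SV := ∑ j ∈ Finset.range J, (AA q (l - L) (v0 + p ^ Kp * j)) ^ 2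
  set SU := ∑ j ∈ Finset.range J, (AA p (κ - Kp) (u0 + q ^ L * j)) ^ 2
  have e3 : (J : ℤ) * (B + 1) ≤ SU + SV := by
    have : ∑ j ∈ Finset.range J, (B + 1) ≤ SU + SV := by
      rw [← Finset.sum_add_distrib]
      apply Finset.sum_le_sum
      intro j hj
      exact hcon j (Finset.mem_range.1 hj)
    simpa using this
  set Md := p ^ Kp * q ^ L with hMd
  have hMd1 : 1 ≤ Md := Nat.mul_pos hP hQ
  have hJ1 : 1 ≤ J := by rw [hJ]; exact Nat.div_pos hMod hMd1
  have hJ2 : q ^ l ≤ 2 * (Md * J) := by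
    have := Nat.lt_mul_div_succ (q ^ l) hMd1
    rw [← hJ] at this
    have h2 : Md * 1 ≤ Md * J := Nat.mul_le_mul_left _ hJ1
    rw [mul_add] at this; omega
  have f1 : (Md : ℤ) * SV ≤ 4 * q ^ 2 * l * q ^ l := by
    have h1 : (q : ℤ) ^ L * q ^ (l - L) = q ^ l := by rw [← pow_add]; congr 1; omega
    have h2 := mul_le_mul_of_nonneg_left e1 (show (0:ℤ) ≤ (q : ℤ) ^ L by positivity)
    have h3 : ((l - L : ℕ) : ℤ) ≤ l := by omega
    calc (Md : ℤ) * SV = (q : ℤ) ^ L * (((p ^ Kp : ℕ) : ℤ) * SV) := by rw [hMd]; push_cast; ring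
      _ ≤ _ := h2
      _ = 4 * q ^ 2 * ((l - L : ℕ) : ℤ) * q ^ l := by rw [← h1]; ring
      _ ≤ _ := by gcongr
  have f2 : (Md : ℤ) * SU ≤ 4 * p ^ 2 * κ * (q ^ 3 * q ^ l) := by
    have h1 : (p : ℤ) ^ Kp * p ^ (κ - Kp) = p ^ κ := by rw [← pow_add]; congr 1; omega
    have h2 := mul_le_mul_of_nonneg_left e2 (show (0:ℤ) ≤ (p : ℤ) ^ Kp by positivity)
    have h3 : ((κ - Kp : ℕ) : ℤ) ≤ κ := by omega
    have h4 : (p : ℤ) ^ κ ≤ q ^ 3 * q ^ l := by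
      rw [← pow_add, add_comm]; exact_mod_cast hk
    calc (Md : ℤ) * SU = (p : ℤ) ^ Kp * (((q ^ L : ℕ) : ℤ) * SU) := by rw [hMd]; push_cast; ring
      _ ≤ _ := h2
      _ = 4 * p ^ 2 * ((κ - Kp : ℕ) : ℤ) * p ^ κ := by rw [← h1]; ring
      _ ≤ _ := by gcongr
  have hBn : 0 ≤ B := by positivity
  have g1 : (Md : ℤ) * (J * (B + 1)) ≤ Md * SU + Md * SV := by
    rw [← mul_add]; exact mul_le_mul_of_nonneg_left e3 (by positivity)
  have g2 : (2 : ℤ) * (Md * SU + Md * SV) ≤ q ^ l * B := by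
    rw [hB]; linarith
  have g3 : (q : ℤ) ^ l * B ≤ 2 * (Md * J) * B :=
    mul_le_mul_of_nonneg_right (by exact_mod_cast hJ2) hBn
  have g4 : (1 : ℤ) ≤ Md * J := by exact_mod_cast Nat.mul_pos hMd1 hJ1
  linarith

theorem cs_aux (a b : ℤ) (ha : 0 ≤ a) (hb : 0 ≤ b) (u v : ℤ) :
    (a * u - b * v) ^ 2 ≤ (a + b) ^ 2 * (u ^ 2 + v ^ 2) := by
  have h : 0 ≤ 2 * a * b * (u ^ 2 + v ^ 2) := by positivity
  have h2 := sq_nonneg (a * v + b * u)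
  linarith

theorem exists_rho {P R : ℕ} (hP : 1 ≤ P) (hR : 1 ≤ R) (hcop : Nat.Coprime P R) (c x y : ℕ) :
    ∃ ρ < P * R, c + ρ ≡ x [MOD P] ∧ c + ρ ≡ y [MOD R] := by
  obtain ⟨z, hz1, hz2⟩ := Nat.chineseRemainder hcop x y
  have hM : 1 ≤ P * R := Nat.mul_pos hP hR
  have key : c + (z + c * (P * R - 1)) % (P * R) ≡ z [MOD P * R] := by
    calc c + (z + c * (P * R - 1)) % (P * R) ≡ c + (z + c * (P * R - 1)) [MOD P * R] :=
          Nat.ModEq.add_left _ (Nat.mod_modEq _ _)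
      _ = z + P * R * c := by
          obtain ⟨d, hd⟩ := Nat.exists_eq_add_of_le hM
          rw [hd]; simp; ring
      _ ≡ z [MOD P * R] := by simp [Nat.ModEq]
  exact ⟨_, Nat.mod_lt _ hM, (key.of_mul_right R).trans hz1, (key.of_mul_left P).trans hz2⟩

set_option maxHeartbeats 2000000 in
theorem wl_core {p q a b : ℕ} (hp : 2 ≤ p) (hq : 2 ≤ q) (hcop : Nat.Coprime p q) (ha : 1 ≤ a)
    (g n K L x y : ℕ) (hg : 1 ≤ g) (hx : x < p ^ K) (hy : y < q ^ L)
    (hgad : ∀ N, N % p ^ K = x → N % q ^ L = y → (g : ℤ) ∣ ff p q a b N ∧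
      ∀ r : ℕ, r < 2 ^ n → ∃ τ, ff p q a b (N + τ) = ff p q a b N + g * r)
    (κ l h Q Kp m1 m1' : ℕ) (hhQ : h * p ^ κ ≤ Q * q ^ l) (hQh : (Q + 1) * q ^ l ≤ (h + 1) * p ^ κ)
    (hk : p ^ κ ≤ q ^ (l + 3)) (hL : L ≤ l) (hKp : Kp ≤ κ)
    (hMod : p ^ Kp * q ^ L ≤ q ^ l)
    (hm1 : 2 * m1 ≤ l - L) (hm1p : p ^ Kp ≤ q ^ m1) (hm2 : 2 * m1' ≤ κ - Kp) (hm2p : q ^ L ≤ p ^ m1')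
    (n3 : |2 * ((b : ℤ) * digitSum q Q - a * digitSum p h) - (a * (p - 1) * κ - b * (q - 1) * l)|
      + 2 * a * (p - 1) * K + 2 * b * (q - 1) * L + g * 2 ^ n ≤ Kp)
    (n4 : 4 * ((a : ℤ) + b) ^ 2 * (8 * p ^ 2 * q ^ 3 * κ + 8 * q ^ 2 * l) ≤ 4 ^ n)
    (n5 : 4 * (a : ℤ) * (p - 1) < 2 ^ n) :
    ∃ N, h * p ^ κ ≤ N ∧ ff p q a b N = 0 := by
  set Δ : ℤ := 2 * ((b : ℤ) * digitSum q Q - a * digitSum p h) - (a * (p - 1) * κ - b * (q - 1) * l) with hΔ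
  have hap : (1 : ℤ) ≤ a * (p - 1) := by
    have h1 : (1:ℤ) ≤ a := by exact_mod_cast ha
    have h2 : (2:ℤ) ≤ p := by exact_mod_cast hp
    nlinarith
  have hbq : (0 : ℤ) ≤ b * (q - 1) := by
    have h2 : (2:ℤ) ≤ q := by exact_mod_cast hq
    have h1 : (0:ℤ) ≤ b := by positivity
    nlinarith
  have hgW : (0 : ℤ) < g * 2 ^ n := by positivity
  have habs := abs_nonneg Δ
  have hΔ1 := le_abs_self Δ
  have hΔ2 := neg_abs_le Δ
  set α : ℤ := a * (p - 1) with hα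
  set β : ℤ := b * (q - 1) with hβ
  have hK0 : (0:ℤ) ≤ K := by positivity
  have hL0 : (0:ℤ) ≤ L := by positivity
  have hαK : (K : ℤ) ≤ α * K := by nlinarith
  have hβL : 0 ≤ β * L := by positivity
  have n3' : |Δ| + 2 * (α * K) + 2 * (β * L) + g * 2 ^ n ≤ Kp := by
    rw [hα, hβ]; linarith
  have hKKp : (K : ℤ) ≤ Kp := by linarith
  have hKKp' : K ≤ Kp := by exact_mod_cast hKKp
  have hKp0 : (Kp : ℤ) ≤ α * Kp := by nlinarith
  have hsx := ds_le hp K hx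
  have hsy := ds_le hq L hy
  have hsx' : (a : ℤ) * digitSum p x ≤ α * K := by
    have h1 : (digitSum p x : ℤ) ≤ (p - 1) * K := by
      have := (Nat.cast_le (α := ℤ)).2 hsx
      rw [Nat.cast_mul, Nat.cast_sub (by omega)] at this; simpa using this
    rw [hα, mul_assoc]; exact mul_le_mul_of_nonneg_left h1 (by positivity)
  have hsy' : (b : ℤ) * digitSum q y ≤ β * L := by
    have h1 : (digitSum q y : ℤ) ≤ (q - 1) * L := by
      have := (Nat.cast_le (α := ℤ)).2 hsy
      rw [Nat.cast_mul, Nat.cast_sub (by omega)] at this; simpa using this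
    rw [hβ, mul_assoc]; exact mul_le_mul_of_nonneg_left h1 (by positivity)
  have hsx0 : (0:ℤ) ≤ (a : ℤ) * digitSum p x := by positivity
  have hsy0 : (0:ℤ) ≤ (b : ℤ) * digitSum q y := by positivity
  -- choose s
  set R0 : ℤ := -Δ + (2 * (a * digitSum p x) - 2 * (b * digitSum q y) + β * L) - α * Kp with hR0
  have hR0a : R0 ≤ - (g * 2 ^ n) := by linarith
  obtain ⟨s, hs⟩ := Int.eq_ofNat_of_zero_le (show 0 ≤ (-(g * 2 ^ n : ℤ) - R0) / (2 * α) from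
    Int.ediv_nonneg (by linarith) (by linarith))
  have hs' : (-(g * 2 ^ n : ℤ) - R0) / (2 * α) = s := by rw [hs]
  have hs1 : 2 * α * s ≤ -(g * 2 ^ n : ℤ) - R0 := by
    rw [← hs']; exact Int.mul_ediv_self_le (by linarith)
  have hs2 : -(g * 2 ^ n : ℤ) - R0 < 2 * α * s + 2 * α := by
    rw [← hs']; exact Int.lt_mul_ediv_self_add (by linarith)
  have hsK : s ≤ Kp - K := by
    by_contra hcon
    have : (Kp : ℤ) - K + 1 ≤ s := by omega
    have h2 : 2 * α * ((Kp : ℤ) - K + 1) ≤ 2 * α * s := mul_le_mul_of_nonneg_left this (by linarith)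
    linarith
  set x' := x + p ^ K * (p ^ s - 1) with hx'
  have hps : 1 ≤ p ^ s := Nat.one_le_pow _ _ (by omega)
  have hx'lt : x' < p ^ Kp := by
    have h1 : x' < p ^ K * p ^ s := digit_lt hx (by omega)
    rw [← pow_add] at h1
    exact lt_of_lt_of_le h1 (Nat.pow_le_pow_right (by omega) (by omega))
  have hdx' : (digitSum p x' : ℤ) = digitSum p x + (p - 1) * s := by
    rw [hx', ds_add hp K hx, ds_pow_sub hp]; push_cast [Nat.cast_sub (show 1 ≤ p by omega)]; ring
  have hPp : 1 ≤ p ^ Kp := Nat.one_le_pow _ _ (by omega)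
  have hQq : 1 ≤ q ^ L := Nat.one_le_pow _ _ (by omega)
  obtain ⟨ρ, hρ, hρ1, hρ2⟩ := exists_rho hPp hQq (Nat.Coprime.pow Kp L hcop) (Q * q ^ l) x' y
  set Md := p ^ Kp * q ^ L with hMd
  have hMd1 : 1 ≤ Md := Nat.mul_pos hPp hQq
  set J := q ^ l / Md with hJ
  obtain ⟨t0, ht0⟩ := Nat.exists_eq_add_of_le hhQ
  have hql : q ^ l = q ^ L * q ^ (l - L) := by rw [← pow_add]; congr 1; omega
  have hpk : p ^ κ = p ^ Kp * p ^ (κ - Kp) := by rw [← pow_add]; congr 1; omega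
  have hwlt : ∀ j < J, ρ + Md * j < q ^ l := by
    intro j hj
    have h1 : ρ + Md * j < Md * J := digit_lt hρ hj
    exact lt_of_lt_of_le h1 (Nat.mul_div_le _ _)
  have htlt : ∀ j < J, t0 + (ρ + Md * j) < p ^ κ := by
    intro j hj
    have := hwlt j hj
    have h2 : (Q + 1) * q ^ l = Q * q ^ l + q ^ l := by ring
    have h3 : (h + 1) * p ^ κ = h * p ^ κ + p ^ κ := by ring
    omega
  -- residue facts
  have hmody : ρ % q ^ L = y := by
    have : Q * q ^ l + ρ ≡ 0 + ρ [MOD q ^ L] := by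
      apply Nat.ModEq.add_right
      rw [hql]; exact (Nat.modEq_zero_iff_dvd).2 ⟨Q * q ^ (l - L), by ring⟩
    have h2 : ρ ≡ y [MOD q ^ L] := by simpa using this.symm.trans hρ2
    rw [← Nat.mod_eq_of_lt hy]; exact h2
  have hmodx : (t0 + ρ) % p ^ Kp = x' := by
    have : h * p ^ κ + (t0 + ρ) ≡ 0 + (t0 + ρ) [MOD p ^ Kp] := by
      apply Nat.ModEq.add_right
      rw [hpk]; exact (Nat.modEq_zero_iff_dvd).2 ⟨h * p ^ (κ - Kp), by ring⟩
    have h2 : t0 + ρ ≡ x' [MOD p ^ Kp] := by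
      have h3 : h * p ^ κ + (t0 + ρ) = Q * q ^ l + ρ := by omega
      rw [h3] at this
      simpa using this.symm.trans hρ1
    rw [← Nat.mod_eq_of_lt hx'lt]; exact h2
  have ev : ∀ j, ρ + Md * j = y + q ^ L * (ρ / q ^ L + p ^ Kp * j) := by
    intro j
    have := Nat.mod_add_div ρ (q ^ L)
    rw [hmody] at this
    conv_lhs => rw [← this]
    rw [hMd]; ring
  have eu : ∀ j, t0 + (ρ + Md * j) = x' + p ^ Kp * ((t0 + ρ) / p ^ Kp + q ^ L * j) := by
    intro j
    have := Nat.mod_add_div (t0 + ρ) (p ^ Kp)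
    rw [hmodx] at this
    rw [← add_assoc, ← this, hMd]
    rw [Nat.add_mul_div_left _ _ hPp, Nat.div_eq_of_lt hx'lt]; ring
  have hv : ∀ j < J, ρ / q ^ L + p ^ Kp * j < q ^ (l - L) := by
    intro j hj
    have h1 := hwlt j hj
    rw [ev, hql] at h1
    exact Nat.lt_of_mul_lt_mul_left (lt_of_le_of_lt (Nat.le_add_left _ _) h1)
  have hu : ∀ j < J, (t0 + ρ) / p ^ Kp + q ^ L * j < p ^ (κ - Kp) := by
    intro j hj
    have h1 := htlt j hj
    rw [eu, hpk] at h1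
    exact Nat.lt_of_mul_lt_mul_left (lt_of_le_of_lt (Nat.le_add_left _ _) h1)
  obtain ⟨j, hj, hjA⟩ := two_avg hp hq hcop κ l Kp L m1 m1' _ _ J hk hL hKp hMod hJ hm1 hm1p hm2 hm2p hv hu
  set v := ρ / q ^ L + p ^ Kp * j with hvdef
  set u := (t0 + ρ) / p ^ Kp + q ^ L * j with hudef
  set N := Q * q ^ l + (ρ + Md * j) with hN
  have hNt : N = h * p ^ κ + (t0 + (ρ + Md * j)) := by omega
  have hdq : digitSum q N = digitSum q Q + digitSum q y + digitSum q v := by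
    rw [hN, add_comm, mul_comm Q, ds_add hq l (hwlt j hj), ev j, ds_add hq L hy]; ring
  have hdp : digitSum p N = digitSum p h + digitSum p x' + digitSum p u := by
    rw [hNt, add_comm, mul_comm h, ds_add hp κ (htlt j hj), eu j, ds_add hp Kp hx'lt]; ring
  clear_value v u N
  set Au := AA p (κ - Kp) u with hAu
  set Av := AA q (l - L) v with hAv
  have hAu' : 2 * (digitSum p u : ℤ) = Au + (p - 1) * (κ - Kp) := by
    rw [hAu]; unfold AA; push_cast [Nat.cast_sub hKp]; ring
  have hAv' : 2 * (digitSum q v : ℤ) = Av + (q - 1) * (l - L) := by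
    rw [hAv]; unfold AA; push_cast [Nat.cast_sub hL]; ring
  clear_value Au Av Δ α β R0 x' J Md
  have hf : 2 * ff p q a b N = R0 + 2 * α * s + (a * Au - b * Av) := by
    have h1 : 2 * ff p q a b N = 2 * a * digitSum p h + 2 * a * digitSum p x' + a * (2 * digitSum p u)
        - 2 * b * digitSum q Q - 2 * b * digitSum q y - b * (2 * digitSum q v) := by
      unfold ff; rw [hdq, hdp]; push_cast; ring
    rw [h1, hAu', hAv', hdx', hR0, hΔ, hα, hβ]; ring
  have hdev : (2 * (a * Au - b * Av)) ^ 2 ≤ ((2:ℤ) ^ n) ^ 2 := by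
    have h1 : (a * Au - b * Av) ^ 2 ≤ ((a:ℤ) + b) ^ 2 * (Au ^ 2 + Av ^ 2) := cs_aux a b (by positivity) (by positivity) Au Av
    have h2 : ((a:ℤ) + b) ^ 2 * (Au ^ 2 + Av ^ 2) ≤ ((a:ℤ) + b) ^ 2 * (8 * p ^ 2 * q ^ 3 * κ + 8 * q ^ 2 * l) :=
      mul_le_mul_of_nonneg_left hjA (by positivity)
    have h3 : ((2:ℤ) ^ n) ^ 2 = 4 ^ n := by rw [← pow_mul, mul_comm, pow_mul]; norm_num
    rw [h3]; linarith
  have hdev2 := abs_le_of_sq_le_sq' hdev (by positivity)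
  have hW : (2:ℤ) ^ n ≤ g * 2 ^ n := by
    have : (1:ℤ) ≤ g := by exact_mod_cast hg
    exact le_mul_of_one_le_left (by positivity) this
  -- gadget residues
  have hNx : N % p ^ K = x := by
    have h1 : N = x + p ^ K * ((p ^ s - 1) + p ^ (Kp - K) * u + p ^ (κ - K) * h) := by
      rw [hNt, eu j, ← hudef, hx']
      have e1 : p ^ Kp = p ^ K * p ^ (Kp - K) := by rw [← pow_add]; congr 1; omega
      have e2 : p ^ κ = p ^ K * p ^ (κ - K) := by rw [← pow_add]; congr 1; omega
      rw [e1, e2]; ring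
    rw [h1, Nat.add_mul_mod_self_left, Nat.mod_eq_of_lt hx]
  have hNy : N % q ^ L = y := by
    have h1 : N = y + q ^ L * (v + q ^ (l - L) * Q) := by
      rw [hN, ev j, ← hvdef, hql]; ring
    rw [h1, Nat.add_mul_mod_self_left, Nat.mod_eq_of_lt hy]
  obtain ⟨⟨w, hw⟩, hτ⟩ := hgad N hNx hNy
  have hle : ff p q a b N ≤ 0 := by linarith [hdev2.2]
  have hlt : -(g * 2 ^ n : ℤ) < ff p q a b N := by
    have n5' : 4 * α < 2 ^ n := by rw [hα]; linarith
    linarith [hdev2.1]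
  have hg' : (0:ℤ) < g := by exact_mod_cast hg
  have hw0 : 0 ≤ -w := by
    rw [hw] at hle; by_contra hc; push Not at hc
    have := mul_pos hg' (show 0 < w by linarith)
    linarith
  obtain ⟨r, hr⟩ := Int.eq_ofNat_of_zero_le hw0
  have hr' : -w = (r : ℤ) := hr
  have hr2 : r < 2 ^ n := by
    have : (r : ℤ) < 2 ^ n := by
      rw [← hr']
      rw [hw] at hlt
      by_contra hc; push Not at hc
      have := mul_le_mul_of_nonneg_left hc hg'.le
      linarith
    exact_mod_cast this
  obtain ⟨τ, hτ2⟩ := hτ r hr2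
  refine ⟨N + τ, by omega, ?_⟩
  rw [hτ2, hw, ← hr']; ring


theorem wl {p q a b : ℕ} (hp : 2 ≤ p) (hq : 2 ≤ q) (hcop : Nat.Coprime p q) (hpq : p ≤ q ^ 2)
    (hqp : q ≤ p ^ 2) (ha : 1 ≤ a) (hG : Gad p q a b) :
    ∃ κ0 : ℕ, ∀ κ l h Q : ℕ, κ0 ≤ κ → h * p ^ κ ≤ Q * q ^ l → (Q + 1) * q ^ l ≤ (h + 1) * p ^ κ →
      p ^ κ ≤ q ^ (l + 3) →
      16 * |2 * ((b : ℤ) * digitSum q Q - a * digitSum p h) - (a * (p - 1) * κ - b * (q - 1) * l)| ≤ κ →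
      ∃ N, h * p ^ κ ≤ N ∧ ff p q a b N = 0 := by
  obtain ⟨g, hg, hG⟩ := hG
  obtain ⟨M, hM⟩ : ∃ M : ℕ, M = 4 * (a + b) ^ 2 * (8 * p ^ 2 * q ^ 3 + 16 * q ^ 2) := ⟨_, rfl⟩
  have hM1 : 1 ≤ M := by rw [hM]; exact Nat.pos_of_ne_zero (by positivity)
  obtain ⟨c, hc⟩ : ∃ c : ℕ, c = 64 * (2 * a * p + 2 * b * q + 4) := ⟨_, rfl⟩
  obtain ⟨n0, hn0⟩ := hG (4 * M * c)
  refine ⟨4 ^ n0 + (4 * a * p + 1) ^ 2 + 16384 * g ^ 2 * M + 200, ?_⟩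
  intro κ l h Q hκ hhQ hQh hk hΔ
  obtain ⟨hκ1, hκ2, hκ3, hκ4⟩ : 4 ^ n0 ≤ κ ∧ (4 * a * p + 1) ^ 2 ≤ κ ∧ 16384 * g ^ 2 * M ≤ κ ∧ 200 ≤ κ := by
    generalize 4 ^ n0 = z1 at *
    generalize (4 * a * p + 1) ^ 2 = z2 at *
    generalize 16384 * g ^ 2 * M = z3 at *
    clear hΔ hk hQh hhQ
    omega
  clear hκ
  obtain ⟨n, hn⟩ : ∃ n, n = Nat.clog 4 (M * κ) := ⟨_, rfl⟩
  have hMκ : κ ≤ M * κ := Nat.le_mul_of_pos_left _ hM1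
  have hna : M * κ ≤ 4 ^ n := by rw [hn]; exact Nat.le_pow_clog (by norm_num) _
  have hnb : 4 ^ n ≤ 4 * (M * κ) := by
    have h1 := Nat.pow_pred_clog_lt_self (b := 4) (by norm_num) (x := M * κ) (by omega)
    rw [← hn] at h1
    have hnpos : 0 < n := by
      rw [hn]; exact Nat.clog_pos (by norm_num) (by omega)
    have h2 : 4 ^ n = 4 * 4 ^ (n.pred) := by
      rw [← pow_succ']; congr 1; exact (Nat.succ_pred_eq_of_pos hnpos).symm
    omega
  have hnn0 : n0 ≤ n := by
    have : 4 ^ n0 ≤ 4 ^ n := by omega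
    exact (Nat.pow_le_pow_iff_right (by norm_num)).1 this
  have hsq : (2 ^ n) ^ 2 = 4 ^ n := by rw [← pow_mul, mul_comm, pow_mul]; norm_num
  have hgW : 64 * (g * 2 ^ n) ≤ κ := by
    have : (64 * (g * 2 ^ n)) ^ 2 ≤ κ ^ 2 := by
      calc (64 * (g * 2 ^ n)) ^ 2 = 4096 * g ^ 2 * (2 ^ n) ^ 2 := by ring
        _ = 4096 * g ^ 2 * 4 ^ n := by rw [hsq]
        _ ≤ 4096 * g ^ 2 * (4 * (M * κ)) := Nat.mul_le_mul_left _ hnb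
        _ = (16384 * g ^ 2 * M) * κ := by ring
        _ ≤ κ * κ := Nat.mul_le_mul_right _ hκ3
        _ = κ ^ 2 := by ring
    exact (Nat.pow_le_pow_iff_left (by norm_num)).1 this
  have hn5 : 4 * a * p < 2 ^ n := by
    have : (4 * a * p + 1) ^ 2 ≤ (2 ^ n) ^ 2 := by rw [hsq]; omega
    exact (Nat.pow_le_pow_iff_left (by norm_num)).1 this
  obtain ⟨K, L, x, y, hKL, hx, hy, hgad⟩ := hn0 n hnn0
  have hKL2 : c * (K + L) ≤ κ := by
    have : 4 * M * (c * (K + L)) ≤ 4 * M * κ := by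
      calc 4 * M * (c * (K + L)) = 4 * M * c * (K + L) := by ring
        _ ≤ 4 ^ n := hKL
        _ ≤ 4 * (M * κ) := hnb
        _ = _ := by ring
    exact Nat.le_of_mul_le_mul_left this (by omega)
  have hLs : 256 * L ≤ κ := by
    have : 256 * L ≤ c * (K + L) := by
      apply Nat.mul_le_mul
      · rw [hc]; omega
      · omega
    omega
  have hKLc : 64 * (2 * a * p * K + 2 * b * q * L) ≤ κ := by
    have : 64 * (2 * a * p * K + 2 * b * q * L) ≤ c * (K + L) := by
      rw [hc]
      have : (64 * (2 * a * p + 2 * b * q + 4)) * (K + L) = 64 * (2 * a * p * K + 2 * b * q * L)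
        + 64 * (2 * a * p * L + 2 * b * q * K + 4 * (K + L)) := by ring
      omega
    omega
  have hlow : κ ≤ 2 * l + 6 := by
    have : p ^ κ ≤ p ^ (2 * (l + 3)) := by
      rw [pow_mul]; exact hk.trans (Nat.pow_le_pow_left hqp _)
    have := (Nat.pow_le_pow_iff_right (by omega)).1 this
    omega
  have hlk : q ^ l ≤ p ^ κ := by
    have h2 : (Q + 1) * q ^ l = Q * q ^ l + q ^ l := by ring
    have h3 : (h + 1) * p ^ κ = h * p ^ κ + p ^ κ := by ring
    omega
  have hup : l ≤ 2 * κ := by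
    have : q ^ l ≤ q ^ (2 * κ) := by
      rw [pow_mul]; exact hlk.trans (Nat.pow_le_pow_left hpq _)
    exact (Nat.pow_le_pow_iff_right (by omega)).1 this
  have hm1p : p ^ (κ / 4) ≤ q ^ ((l + 3) / 4 + 1) := by
    have : (p ^ (κ / 4)) ^ 4 ≤ (q ^ ((l + 3) / 4 + 1)) ^ 4 := by
      rw [← pow_mul, ← pow_mul]
      calc p ^ (κ / 4 * 4) ≤ p ^ κ := Nat.pow_le_pow_right (by omega) (by omega)
        _ ≤ q ^ (l + 3) := hk
        _ ≤ _ := Nat.pow_le_pow_right (by omega) (by omega)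
    exact (Nat.pow_le_pow_iff_left (by norm_num)).1 this
  refine wl_core hp hq hcop ha g n K L x y hg hx hy hgad κ l h Q (κ / 4) ((l + 3) / 4 + 1) (2 * L)
    hhQ hQh hk (by omega) (by omega) ?_ (by omega) hm1p (by omega) ?_ ?_ ?_ ?_
  · calc p ^ (κ / 4) * q ^ L ≤ q ^ ((l + 3) / 4 + 1) * q ^ L := Nat.mul_le_mul_right _ hm1p
      _ = q ^ ((l + 3) / 4 + 1 + L) := (pow_add _ _ _).symm
      _ ≤ q ^ l := Nat.pow_le_pow_right (by omega) (by omega)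
  · rw [pow_mul]; exact Nat.pow_le_pow_left hqp _
  · have e1 : 64 * (2 * (a:ℤ) * p * K + 2 * b * q * L) ≤ κ := by exact_mod_cast hKLc
    have e2 : 64 * ((g : ℤ) * 2 ^ n) ≤ κ := by exact_mod_cast hgW
    have e3 : (κ : ℤ) ≤ 4 * ((κ / 4 : ℕ) : ℤ) + 3 := by omega
    have e4 : (200 : ℤ) ≤ κ := by exact_mod_cast hκ4
    have e5 : 2 * (a:ℤ) * (p - 1) * K ≤ 2 * (a:ℤ) * p * K := by
      have : (0:ℤ) ≤ 2 * a * K := by positivity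
      linarith
    have e6 : 2 * (b:ℤ) * (q - 1) * L ≤ 2 * (b:ℤ) * q * L := by
      have : (0:ℤ) ≤ 2 * b * L := by positivity
      linarith
    linarith
  · have e1 : (M : ℤ) * κ ≤ 4 ^ n := by exact_mod_cast hna
    have e2 : (l : ℤ) ≤ 2 * κ := by exact_mod_cast hup
    refine le_trans ?_ e1
    rw [hM]; push_cast
    calc 4 * ((a:ℤ) + b) ^ 2 * (8 * p ^ 2 * q ^ 3 * κ + 8 * q ^ 2 * l)
        ≤ 4 * ((a:ℤ) + b) ^ 2 * (8 * p ^ 2 * q ^ 3 * κ + 8 * q ^ 2 * (2 * κ)) := by gcongr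
      _ = _ := by ring
  · have e1 : 4 * (a:ℤ) * p < 2 ^ n := by exact_mod_cast hn5
    have : (0:ℤ) ≤ 4 * a := by positivity
    linarith


theorem fit_interval {s R A : ℕ} (hs : 1 ≤ s) (h : 2 * s ≤ R) : ∃ h', A ≤ h' * s ∧ (h' + 1) * s ≤ A + R := by
  refine ⟨(A + s - 1) / s, ?_, ?_⟩
  · have := Nat.lt_mul_div_succ (A + s - 1) hs
    rw [mul_add] at this
    rw [mul_comm]; omega
  · have := Nat.div_mul_le_self (A + s - 1) s
    rw [add_mul]; omega

theorem ds_sub_bound {q : ℕ} (hq : 2 ≤ q) (d Q Q' : ℕ) (h1 : Q * q ^ d ≤ Q') (h2 : Q' < (Q + 1) * q ^ d) :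
    (digitSum q Q : ℤ) ≤ digitSum q Q' ∧ (digitSum q Q' : ℤ) ≤ digitSum q Q + (q - 1) * d := by
  have e : Q' / q ^ d = Q := Nat.div_eq_of_lt_le h1 h2
  have h3 := ds_split hq d Q'
  have h4 := ds_le hq d (Nat.mod_lt Q' (show 0 < q ^ d by positivity))
  rw [e] at h3
  have h4' : (digitSum q (Q' % q ^ d) : ℤ) ≤ (q - 1) * d := by
    have := (Nat.cast_le (α := ℤ)).2 h4
    rw [Nat.cast_mul, Nat.cast_sub (by omega)] at this; simpa using this
  rw [h3]; push_cast
  constructor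
  · have : (0:ℤ) ≤ digitSum q (Q' % q ^ d) := by positivity
    linarith
  · linarith

set_option maxHeartbeats 1000000 in
theorem il {p q a b : ℕ} (hp : 2 ≤ p) (hq : 2 ≤ q) (hcop : Nat.Coprime p q) (hpq : p ≤ q ^ 2)
    (hqp : q ≤ p ^ 2) (ha : 1 ≤ a) (hG : Gad p q a b) :
    ∃ G κ0 : ℕ, 1 ≤ G ∧ ∀ P κ j : ℕ, κ0 ≤ κ → 4 ≤ j → G * j ≤ κ → p ^ (κ - j) ≤ P % p ^ κ →
      P % p ^ κ + p ^ (κ - j) ≤ p ^ κ →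
      32 * |2 * ((b : ℤ) * digitSum q (P / q ^ (Nat.log q (p ^ κ))) - a * digitSum p (P / p ^ κ))
        - (a * (p - 1) * κ - b * (q - 1) * (Nat.log q (p ^ κ) : ℕ))| ≤ κ →
      ∃ N, P / p ^ κ * p ^ κ ≤ N ∧ ff p q a b N = 0 := by
  obtain ⟨κ0, hw⟩ := wl hp hq hcop hpq hqp ha hG
  refine ⟨64 * (9 * b * q + 6 * a * p) + 64, 2 * κ0 + 100, by omega, ?_⟩
  intro P κ j hκ hj hGj hlow hhigh hΔ
  obtain ⟨l, hl⟩ : ∃ l, l = Nat.log q (p ^ κ) := ⟨_, rfl⟩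
  rw [← hl] at hΔ
  have hl1 : q ^ l ≤ p ^ κ := by rw [hl]; exact Nat.pow_log_le_self q (by positivity)
  have hl2 : p ^ κ < q ^ (l + 1) := by rw [hl]; exact Nat.lt_pow_succ_log_self (by omega) _
  have hGj' : 64 * (9 * b * q + 6 * a * p) * j + 64 * j ≤ κ := by rw [← add_mul]; exact hGj
  have hjs : 64 * j ≤ κ := by omega
  set R := p ^ (κ - j) with hR
  set h := P / p ^ κ with hh
  set Q := P / q ^ l with hQ
  have hRpos : 1 ≤ R := Nat.one_le_pow _ _ (by omega)
  have hRp : R * p ^ j = p ^ κ := by rw [hR, ← pow_add]; congr 1; omega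
  have hpj : 2 * q ≤ p ^ j := by
    calc 2 * q ≤ q * q := Nat.mul_le_mul_right _ hq
      _ ≤ p ^ 2 * p ^ 2 := Nat.mul_le_mul hqp hqp
      _ = p ^ 4 := by ring
      _ ≤ p ^ j := Nat.pow_le_pow_right (by omega) hj
  have h2R : 2 * R ≤ q ^ l := by
    have : q * (2 * R) < q * q ^ l := by
      calc q * (2 * R) = R * (2 * q) := by ring
        _ ≤ R * p ^ j := Nat.mul_le_mul_left _ hpj
        _ = p ^ κ := hRp
        _ < q ^ (l + 1) := hl2
        _ = q * q ^ l := by ring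
    exact (Nat.lt_of_mul_lt_mul_left this).le
  have hPp : p ^ κ * h + P % p ^ κ = P := Nat.div_add_mod P (p ^ κ)
  have hPq : q ^ l * Q + P % q ^ l = P := Nat.div_add_mod P (q ^ l)
  have hPq2 : P % q ^ l < q ^ l := Nat.mod_lt _ (by positivity)
  obtain ⟨A, hA1, hA2, hA3, hA4⟩ : ∃ A, q ^ l * Q ≤ A ∧ p ^ κ * h ≤ A ∧ A + R ≤ q ^ l * Q + q ^ l ∧
      A + R ≤ p ^ κ * h + p ^ κ := by
    by_cases hc : R ≤ P % q ^ l
    · exact ⟨P - R, by omega, by omega, by omega, by omega⟩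
    · have hz : 0 ≤ P % q ^ l := Nat.zero_le _
      generalize P % q ^ l = z at *
      exact ⟨P, by omega, by omega, by omega, by omega⟩
  obtain ⟨κ', hκ'⟩ : ∃ κ', κ' = κ - j - 1 := ⟨_, rfl⟩
  have hκj : κ = κ' + (j + 1) := by omega
  have hs1 : 1 ≤ p ^ κ' := Nat.one_le_pow _ _ (by omega)
  have hRs : R = p * p ^ κ' := by rw [hR, ← pow_succ']; congr 1; omega
  obtain ⟨h', hh1, hh2⟩ := fit_interval (A := A) hs1 (show 2 * p ^ κ' ≤ R by
    rw [hRs]; exact Nat.mul_le_mul_right _ hp)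
  obtain ⟨l', hl'⟩ : ∃ l', l' = Nat.log q (p ^ κ') - 1 := ⟨_, rfl⟩
  have hlog : 1 ≤ Nat.log q (p ^ κ') := by
    apply Nat.log_pos (by omega)
    exact hqp.trans (Nat.pow_le_pow_right (by omega) (by omega))
  have hl'1 : q ^ (l' + 1) ≤ p ^ κ' := by
    rw [hl', Nat.sub_add_cancel hlog]; exact Nat.pow_log_le_self q (by positivity)
  have hl'2 : p ^ κ' < q ^ (l' + 2) := by
    have : l' + 2 = Nat.log q (p ^ κ') + 1 := by omega
    rw [this]; exact Nat.lt_pow_succ_log_self (by omega) _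
  obtain ⟨Q', hQ1, hQ2⟩ := fit_interval (A := h' * p ^ κ') (Nat.one_le_pow l' q (by omega))
    (show 2 * q ^ l' ≤ p ^ κ' by
      rw [pow_succ'] at hl'1; exact (Nat.mul_le_mul_right _ hq).trans hl'1)
  have hll : l' ≤ l := by
    have : q ^ l' < q ^ (l + 1) := by
      calc q ^ l' ≤ q ^ (l' + 1) := Nat.pow_le_pow_right (by omega) (by omega)
        _ ≤ p ^ κ' := hl'1
        _ ≤ p ^ κ := Nat.pow_le_pow_right (by omega) (by omega)
        _ < _ := hl2
    have := (Nat.pow_lt_pow_iff_right (by omega)).1 this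
    omega
  obtain ⟨d, hd⟩ := Nat.exists_eq_add_of_le hll
  have hd2 : d ≤ 3 * j := by
    have : q ^ l < q ^ (l' + 2 + 2 * (j + 1)) := by
      calc q ^ l ≤ p ^ κ := hl1
        _ = p ^ κ' * p ^ (j + 1) := by rw [hκj, pow_add]
        _ ≤ p ^ κ' * q ^ (2 * (j + 1)) := by
            apply Nat.mul_le_mul_left; rw [pow_mul]; exact Nat.pow_le_pow_left hpq _
        _ < q ^ (l' + 2) * q ^ (2 * (j + 1)) := Nat.mul_lt_mul_of_pos_right hl'2 (by positivity)
        _ = _ := by rw [← pow_add]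
    have := (Nat.pow_lt_pow_iff_right (by omega)).1 this
    omega
  have e1 : h' * p ^ κ' + p ^ κ' = (h' + 1) * p ^ κ' := by ring
  have e2 : Q' * q ^ l' + q ^ l' = (Q' + 1) * q ^ l' := by ring
  have bp := ds_sub_bound hp (j + 1) h h' (by
      apply Nat.le_of_mul_le_mul_right _ hs1
      calc h * p ^ (j + 1) * p ^ κ' = p ^ κ * h := by rw [hκj, pow_add]; ring
        _ ≤ h' * p ^ κ' := by omega) (by
      apply Nat.lt_of_mul_lt_mul_right (a := p ^ κ')
      calc h' * p ^ κ' < p ^ κ * h + p ^ κ := by omega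
        _ = (h + 1) * p ^ (j + 1) * p ^ κ' := by rw [hκj, pow_add]; ring)
  have hqs1 : 1 ≤ q ^ l' := Nat.one_le_pow _ _ (by omega)
  have bq := ds_sub_bound hq d Q Q' (by
      apply Nat.le_of_mul_le_mul_right _ hqs1
      calc Q * q ^ d * q ^ l' = q ^ l * Q := by rw [hd, pow_add]; ring
        _ ≤ Q' * q ^ l' := by omega) (by
      apply Nat.lt_of_mul_lt_mul_right (a := q ^ l')
      calc Q' * q ^ l' < q ^ l * Q + q ^ l := by omega
        _ = (Q + 1) * q ^ d * q ^ l' := by rw [hd, pow_add]; ring)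
  obtain ⟨N, hN1, hN2⟩ := hw κ' l' h' Q' (by omega) hQ1 (by omega)
    (hl'2.le.trans (Nat.pow_le_pow_right (by omega) (by omega))) (by
      have hp' : (2:ℤ) ≤ p := by exact_mod_cast hp
      have hq' : (2:ℤ) ≤ q := by exact_mod_cast hq
      have ha0 : (0:ℤ) ≤ a := by positivity
      have hb0 : (0:ℤ) ≤ b := by positivity
      have hj0 : (4:ℤ) ≤ j := by exact_mod_cast hj
      have hdj : (d:ℤ) ≤ 3 * j := by exact_mod_cast hd2
      have hd0 : (0:ℤ) ≤ d := by positivity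
      have c1 : (κ : ℤ) = κ' + (j + 1) := by rw [hκj]; push_cast; ring
      have c2 : (l : ℤ) = l' + d := by rw [hd]; push_cast; ring
      have c3 : 64 * (9 * (b:ℤ) * q + 6 * a * p) * j + 64 * j ≤ κ := by exact_mod_cast hGj'
      have g1 : (b:ℤ) * digitSum q Q ≤ b * digitSum q Q' := mul_le_mul_of_nonneg_left bq.1 hb0
      have g2 := mul_le_mul_of_nonneg_left bq.2 hb0
      have g3 : (a:ℤ) * digitSum p h ≤ a * digitSum p h' := mul_le_mul_of_nonneg_left bp.1 ha0
      have g4 := mul_le_mul_of_nonneg_left bp.2 ha0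
      have k1 : (b:ℤ) * ((q - 1) * d) ≤ 3 * (b * q * j) := by
        calc (b:ℤ) * ((q - 1) * d) ≤ b * (q * (3 * j)) := by
              apply mul_le_mul_of_nonneg_left _ hb0
              apply mul_le_mul <;> linarith
          _ = _ := by ring
      have k2 : (a:ℤ) * ((p - 1) * (j + 1)) ≤ 2 * (a * p * j) := by
        calc (a:ℤ) * ((p - 1) * (j + 1)) ≤ a * (p * (2 * j)) := by
              apply mul_le_mul_of_nonneg_left _ ha0
              apply mul_le_mul <;> linarith
          _ = _ := by ring
      have k3 : 0 ≤ (b:ℤ) * ((q - 1) * d) := mul_nonneg hb0 (mul_nonneg (by linarith) hd0)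
      have k4 : 0 ≤ (a:ℤ) * ((p - 1) * (j + 1)) := mul_nonneg ha0 (mul_nonneg (by linarith) (by linarith))
      push_cast at g4
      rw [mul_add] at g2 g4
      have m1 : (a:ℤ) * (p - 1) * κ = a * (p - 1) * κ' + a * ((p - 1) * (j + 1)) := by rw [c1]; ring
      have m2 : (b:ℤ) * (q - 1) * l = b * (q - 1) * l' + b * ((q - 1) * d) := by rw [c2]; ring
      rw [m1, m2] at hΔ
      have hu := le_abs_self (2 * ((b : ℤ) * digitSum q Q - a * digitSum p h)
        - (a * (p - 1) * κ' + a * ((p - 1) * (j + 1)) - (b * (q - 1) * l' + b * ((q - 1) * d))))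
      have hv := neg_abs_le (2 * ((b : ℤ) * digitSum q Q - a * digitSum p h)
        - (a * (p - 1) * κ' + a * ((p - 1) * (j + 1)) - (b * (q - 1) * l' + b * ((q - 1) * d))))
      have fin : |2 * ((b : ℤ) * digitSum q Q' - a * digitSum p h') - (a * (p - 1) * κ' - b * (q - 1) * l')|
          ≤ κ' / 16 := by
        have w : 16 * (|2 * ((b : ℤ) * digitSum q Q - a * digitSum p h)
          - (a * (p - 1) * κ' + a * ((p - 1) * (j + 1)) - (b * (q - 1) * l' + b * ((q - 1) * d)))|
          + (9 * (b * q * j) + 6 * (a * p * j))) ≤ κ' := by linarith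
        have w2 := (Int.le_ediv_iff_mul_le (show (0:ℤ) < 16 by norm_num)).2 (le_of_eq_of_le (mul_comm _ _) w)
        refine le_trans ?_ w2
        rw [abs_le]
        constructor
        · linarith
        · linarith
      have := Int.ediv_mul_le (κ' : ℤ) (show (16:ℤ) ≠ 0 by norm_num)
      linarith)
  refine ⟨N, ?_, hN2⟩
  rw [mul_comm]; omega


/-- Separation of the residues of powers of `p` modulo `q ^ l`. -/
def SepT (p q l Y : ℕ) (T : Finset ℕ) : Prop :=
  ∀ κ ∈ T, ∀ κ' ∈ T, κ < κ' → ∀ s : ℤ, |s| < Y → ¬ ((q : ℤ) ^ l ∣ (p : ℤ) ^ κ' - (p : ℤ) ^ κ - s)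

theorem tlem {p q : ℕ} (hp : 2 ≤ p) (hq : 2 ≤ q) (hcop : Nat.Coprime p q) (hpq : p ≤ q ^ 2)
    (hqp : q ≤ p ^ 2) (m l : ℕ) (hm : 2 ≤ m) (hl : 5 * m ≤ l) (κ0 : ℕ) :
    ∃ T : Finset ℕ, T.card = m ∧ (∀ κ ∈ T, κ0 ≤ κ ∧ κ < κ0 + 2 * l) ∧
      SepT p q l (q ^ (l - 5 * m)) T := by
  by_cases hS : SepT p q l (q ^ (l - 5 * m)) (Finset.Ico κ0 (κ0 + m))
  · refine ⟨_, by simp, ?_, hS⟩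
    intro κ hκ
    rw [Finset.mem_Ico] at hκ
    omega
  unfold SepT at hS
  push Not at hS
  obtain ⟨κ, hκ, κ', hκ', hlt, z0, hz0, hdvd⟩ := hS
  rw [Finset.mem_Ico] at hκ hκ'
  obtain ⟨d, hd, rfl⟩ : ∃ d, 1 ≤ d ∧ κ' = κ + d := ⟨κ' - κ, by omega, by omega⟩
  obtain ⟨Y, hY⟩ : ∃ Y, Y = q ^ (l - 5 * m) := ⟨_, rfl⟩
  rw [← hY] at hz0 ⊢
  have hYl : q ^ (5 * m) * Y = q ^ l := by rw [hY, ← pow_add]; congr 1; omega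
  have hYp : Y ≤ p ^ (2 * (l - 5 * m)) := by rw [hY, pow_mul]; exact Nat.pow_le_pow_left hqp _
  have hY1 : 1 ≤ Y := by rw [hY]; exact Nat.one_le_pow _ _ (by omega)
  have hpow : p ^ (2 * m + 1) ≤ q ^ (5 * m) := by
    calc p ^ (2 * m + 1) ≤ (q ^ 2) ^ (2 * m + 1) := Nat.pow_le_pow_left hpq _
      _ = q ^ (2 * (2 * m + 1)) := by rw [pow_mul]
      _ ≤ _ := Nat.pow_le_pow_right (by omega) (by omega)
  have hpz : (2 : ℤ) ≤ p := by exact_mod_cast hp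
  have hYz : (1 : ℤ) ≤ Y := by exact_mod_cast hY1
  have hpd : (2 : ℤ) ≤ (p : ℤ) ^ d := hpz.trans (le_self_pow₀ (by linarith) (by omega))
  have hz0ne : z0 ≠ 0 := by
    rintro rfl
    have h1 : (q : ℤ) ^ l ∣ (p : ℤ) ^ κ * ((p : ℤ) ^ d - 1) := by
      convert hdvd using 1; rw [pow_add]; ring
    have hc : IsCoprime ((q : ℤ) ^ l) ((p : ℤ) ^ κ) :=
      (Nat.isCoprime_iff_coprime.2 hcop.symm).pow
    have h2 := Int.le_of_dvd (by linarith) (hc.dvd_of_dvd_mul_left h1)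
    have h3 : p ^ d ≤ q ^ l := by
      calc p ^ d ≤ p ^ (2 * m + 1) := Nat.pow_le_pow_right (by omega) (by omega)
        _ ≤ q ^ (5 * m) := hpow
        _ ≤ _ := Nat.pow_le_pow_right (by omega) hl
    have h4 : (p : ℤ) ^ d ≤ (q : ℤ) ^ l := by exact_mod_cast h3
    linarith
  have hz1 : 1 ≤ |z0| := Int.one_le_abs hz0ne
  have hex : ∃ j, (p : ℤ) ^ (d + 1) * Y ≤ |z0| * (p : ℤ) ^ j := by
    refine ⟨d + 1 + 2 * (l - 5 * m), ?_⟩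
    have h1 : p ^ (d + 1) * Y ≤ p ^ (d + 1 + 2 * (l - 5 * m)) := by
      rw [pow_add p (d + 1)]; exact Nat.mul_le_mul_left _ hYp
    have h2 : (p : ℤ) ^ (d + 1) * Y ≤ (p : ℤ) ^ (d + 1 + 2 * (l - 5 * m)) := by exact_mod_cast h1
    refine h2.trans ?_
    exact le_mul_of_one_le_left (by positivity) hz1
  classical
  obtain ⟨j, hj⟩ : ∃ j, j = Nat.find hex := ⟨_, rfl⟩
  have hj1 : (p : ℤ) ^ (d + 1) * Y ≤ |z0| * (p : ℤ) ^ j := by rw [hj]; exact Nat.find_spec hex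
  have hj2 : |z0| * (p : ℤ) ^ j ≤ (p : ℤ) ^ (d + 2) * Y := by
    rcases Nat.eq_zero_or_pos j with h0 | h0
    · rw [h0, pow_zero, mul_one]
      refine hz0.le.trans (le_mul_of_one_le_left (by positivity) (one_le_pow₀ (by linarith)))
    · have h1 := Nat.find_min hex (m := j - 1) (by omega)
      push Not at h1
      have h2 : (p : ℤ) ^ j = (p : ℤ) ^ (j - 1) * p := by rw [← pow_succ]; congr 1; omega
      rw [h2]
      calc |z0| * ((p : ℤ) ^ (j - 1) * p) = p * (|z0| * (p : ℤ) ^ (j - 1)) := by ring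
        _ ≤ p * ((p : ℤ) ^ (d + 1) * Y) := mul_le_mul_of_nonneg_left h1.le (by linarith)
        _ = _ := by ring
  have hjle : j ≤ d + 1 + 2 * (l - 5 * m) := by
    rw [hj]; apply Nat.find_min'
    have h1 : p ^ (d + 1) * Y ≤ p ^ (d + 1 + 2 * (l - 5 * m)) := by
      rw [pow_add p (d + 1)]; exact Nat.mul_le_mul_left _ hYp
    have h2 : (p : ℤ) ^ (d + 1) * Y ≤ (p : ℤ) ^ (d + 1 + 2 * (l - 5 * m)) := by exact_mod_cast h1
    refine h2.trans ?_
    exact le_mul_of_one_le_left (by positivity) hz1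
  refine ⟨Finset.Ico (κ + j) (κ + j + m), by simp, ?_, ?_⟩
  · intro x hx; rw [Finset.mem_Ico] at hx; omega
  intro x hx x' hx' hxx s hs hds
  rw [Finset.mem_Ico] at hx hx'
  obtain ⟨i, rfl⟩ : ∃ i, x = κ + j + i := ⟨x - (κ + j), by omega⟩
  obtain ⟨e, he, rfl⟩ : ∃ e, 1 ≤ e ∧ x' = κ + j + i + e := ⟨x' - (κ + j + i), by omega, by omega⟩
  have hpe : (2 : ℤ) ≤ (p : ℤ) ^ e := hpz.trans (le_self_pow₀ (by linarith) (by omega))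
  -- the nonzero multiple
  have hdv : (q : ℤ) ^ l ∣ z0 * (p : ℤ) ^ (j + i) * ((p : ℤ) ^ e - 1) - s * ((p : ℤ) ^ d - 1) := by
    have h1 := (hds.mul_right ((p : ℤ) ^ d - 1)).sub (hdvd.mul_right ((p : ℤ) ^ (j + i) * ((p : ℤ) ^ e - 1)))
    have h2 : z0 * (p : ℤ) ^ (j + i) * ((p : ℤ) ^ e - 1) - s * ((p : ℤ) ^ d - 1) =
        ((p : ℤ) ^ (κ + j + i + e) - (p : ℤ) ^ (κ + j + i) - s) * ((p : ℤ) ^ d - 1) -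
        ((p : ℤ) ^ (κ + d) - (p : ℤ) ^ κ - z0) * ((p : ℤ) ^ (j + i) * ((p : ℤ) ^ e - 1)) := by
      simp only [pow_add]; ring
    rw [h2]; exact h1
  have hsd : |s * ((p : ℤ) ^ d - 1)| < (p : ℤ) ^ d * Y := by
    rw [abs_mul, abs_of_nonneg (show (0:ℤ) ≤ (p : ℤ) ^ d - 1 by linarith)]
    have hs0 := abs_nonneg s
    nlinarith
  have hW : |z0 * (p : ℤ) ^ (j + i) * ((p : ℤ) ^ e - 1)| = |z0| * (p : ℤ) ^ j * (p : ℤ) ^ i * ((p : ℤ) ^ e - 1) := by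
    rw [abs_mul, abs_mul, abs_of_nonneg (show (0:ℤ) ≤ (p : ℤ) ^ e - 1 by linarith),
      abs_of_nonneg (show (0:ℤ) ≤ (p : ℤ) ^ (j + i) by positivity), pow_add]; ring
  have hpi : (1 : ℤ) ≤ (p : ℤ) ^ i := one_le_pow₀ (by linarith)
  have hWl : (p : ℤ) ^ (d + 1) * Y ≤ |z0 * (p : ℤ) ^ (j + i) * ((p : ℤ) ^ e - 1)| := by
    rw [hW]
    refine hj1.trans ?_
    rw [mul_assoc]
    refine le_mul_of_one_le_right (by positivity) ?_
    exact one_le_mul_of_one_le_of_one_le hpi (by linarith)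
  have hWu : |z0 * (p : ℤ) ^ (j + i) * ((p : ℤ) ^ e - 1)| ≤ (p : ℤ) ^ (2 * m) * Y := by
    rw [hW]
    calc |z0| * (p : ℤ) ^ j * (p : ℤ) ^ i * ((p : ℤ) ^ e - 1)
        ≤ |z0| * (p : ℤ) ^ j * (p : ℤ) ^ i * (p : ℤ) ^ e :=
          mul_le_mul_of_nonneg_left (by linarith) (by positivity)
      _ = |z0| * (p : ℤ) ^ j * (p : ℤ) ^ (i + e) := by rw [pow_add]; ring
      _ ≤ (p : ℤ) ^ (d + 2) * Y * (p : ℤ) ^ (i + e) := mul_le_mul_of_nonneg_right hj2 (by positivity)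
      _ = (p : ℤ) ^ (d + 2 + (i + e)) * Y := by rw [pow_add _ (d + 2)]; ring
      _ ≤ _ := mul_le_mul_of_nonneg_right (pow_le_pow_right₀ (by linarith) (by omega)) (by positivity)
  have hd1 : (p : ℤ) ^ d * Y ≤ (p : ℤ) ^ (d + 1) * Y :=
    mul_le_mul_of_nonneg_right (pow_le_pow_right₀ (by linarith) (by omega)) (by positivity)
  have hd2 : (p : ℤ) ^ d * Y ≤ (p : ℤ) ^ (2 * m) * Y :=
    mul_le_mul_of_nonneg_right (pow_le_pow_right₀ (by linarith) (by omega)) (by positivity)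
  have htot : 2 * ((p : ℤ) ^ (2 * m) * Y) ≤ (q : ℤ) ^ l := by
    have : 2 * (p ^ (2 * m) * Y) ≤ q ^ l := by
      rw [← hYl]
      calc 2 * (p ^ (2 * m) * Y) ≤ p * (p ^ (2 * m) * Y) := Nat.mul_le_mul_right _ hp
        _ = p ^ (2 * m + 1) * Y := by ring
        _ ≤ _ := Nat.mul_le_mul_right _ hpow
    exact_mod_cast this
  have hne : z0 * (p : ℤ) ^ (j + i) * ((p : ℤ) ^ e - 1) - s * ((p : ℤ) ^ d - 1) ≠ 0 := by
    intro h0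
    rw [sub_eq_zero] at h0
    rw [h0] at hWl
    linarith
  have h5 := Int.le_of_dvd (abs_pos.2 hne) ((dvd_abs _ _).2 hdv)
  have h6 := abs_sub (z0 * (p : ℤ) ^ (j + i) * ((p : ℤ) ^ e - 1)) (s * ((p : ℤ) ^ d - 1))
  linarith


/-- Iterated sum over shifts by powers of `p`. -/
def SS (p : ℕ) (A : Finset ℕ) : ℕ → (ℕ → ℕ) → ℕ → ℕ
  | 0, φ, y => φ y
  | k + 1, φ, y => ∑ κ ∈ A, SS p A k φ (y + p ^ κ)

/-- Sums of `k` powers of `p` with exponents in `A`. -/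
def SumPow (p : ℕ) (A : Finset ℕ) : ℕ → ℕ → Prop
  | 0, X => X = 0
  | k + 1, X => ∃ κ ∈ A, ∃ X', SumPow p A k X' ∧ X = p ^ κ + X'

/-- Indicator of a zero window. -/
def ind (q l Y z : ℕ) : ℕ := if z % q ^ l < Y then 1 else 0

theorem ind_le_one (q l Y z : ℕ) : ind q l Y z ≤ 1 := by
  unfold ind; split_ifs <;> omega

theorem SS_sum {ι : Type} (p : ℕ) (A : Finset ℕ) (S : Finset ι) (φ : ι → ℕ → ℕ) (k : ℕ) : ∀ y,
    SS p A k (fun z => ∑ i ∈ S, φ i z) y = ∑ i ∈ S, SS p A k (φ i) y := by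
  induction k with
  | zero => intro y; simp [SS]
  | succ k ih =>
    intro y
    simp only [SS, ih]
    rw [Finset.sum_comm]

theorem SS_exists (p : ℕ) (A : Finset ℕ) (hA : 1 ≤ A.card) (φ : ℕ → ℕ) (c w : ℕ) (k : ℕ) : ∀ y,
    w * SS p A k φ y ≤ c * A.card ^ k → ∃ X, SumPow p A k X ∧ w * φ (y + X) ≤ c := by
  induction k with
  | zero => intro y h; exact ⟨0, rfl, by simpa [SS] using h⟩
  | succ k ih =>
    intro y h
    simp only [SS] at h
    rw [Finset.mul_sum] at h
    obtain ⟨κ, hκ, h2⟩ : ∃ κ ∈ A, w * SS p A k φ (y + p ^ κ) ≤ c * A.card ^ k := by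
      by_contra hcon
      push Not at hcon
      have := Finset.sum_lt_sum_of_nonempty (Finset.card_pos.1 hA) hcon
      rw [Finset.sum_const, smul_eq_mul] at this
      rw [pow_succ] at h
      nlinarith
    obtain ⟨X, hX, h3⟩ := ih _ h2
    exact ⟨p ^ κ + X, ⟨κ, hκ, X, hX, rfl⟩, by rw [← add_assoc]; exact h3⟩

theorem sep_sum {p q l Y : ℕ} {T : Finset ℕ} (hT : SepT p q l Y T) (A : Finset ℕ) (k : ℕ) : ∀ y,
    ∑ κ ∈ T, SS p A k (ind q l Y) (y + p ^ κ) ≤ A.card ^ k := by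
  induction k with
  | zero =>
    intro y
    simp only [SS, pow_zero, ind]
    rw [Finset.sum_boole, Nat.cast_id, Finset.card_le_one]
    have key : ∀ κ ∈ T, ∀ κ' ∈ T, κ < κ' → (y + p ^ κ) % q ^ l < Y → (y + p ^ κ') % q ^ l < Y → False := by
      intro κ hκ κ' hκ' hlt h1 h2
      refine hT κ hκ κ' hκ' hlt (((y + p ^ κ') % q ^ l : ℕ) - ((y + p ^ κ) % q ^ l : ℕ)) ?_ ?_
      · generalize (y + p ^ κ) % q ^ l = u at *
        generalize (y + p ^ κ') % q ^ l = v at *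
        rw [abs_lt]; omega
      · have e1 := Nat.div_add_mod (y + p ^ κ') (q ^ l)
        have e2 := Nat.div_add_mod (y + p ^ κ) (q ^ l)
        refine ⟨((y + p ^ κ') / q ^ l : ℕ) - ((y + p ^ κ) / q ^ l : ℕ), ?_⟩
        have e1' : (q : ℤ) ^ l * ((y + p ^ κ') / q ^ l : ℕ) + ((y + p ^ κ') % q ^ l : ℕ) = y + (p : ℤ) ^ κ' := by
          exact_mod_cast e1
        have e2' : (q : ℤ) ^ l * ((y + p ^ κ) / q ^ l : ℕ) + ((y + p ^ κ) % q ^ l : ℕ) = y + (p : ℤ) ^ κ := by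
          exact_mod_cast e2
        rw [mul_sub]; linarith
    intro x hx x' hx'
    rw [Finset.mem_filter] at hx hx'
    rcases lt_trichotomy x x' with h | h | h
    · exact (key x hx.1 x' hx'.1 h hx.2 hx'.2).elim
    · exact h
    · exact (key x' hx'.1 x hx.1 h hx'.2 hx.2).elim
  | succ k ih =>
    intro y
    simp only [SS]
    rw [Finset.sum_comm, pow_succ, mul_comm, ← smul_eq_mul]
    apply Finset.sum_le_card_nsmul
    intro κ hκ
    refine le_trans (le_of_eq ?_) (ih (y + p ^ κ))
    apply Finset.sum_congr rfl
    intro κ' _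
    rw [add_right_comm]

theorem block_sum (f : ℕ → ℝ) (M S : ℝ) (e L m : ℕ) (T : Finset ℕ) (hT : T.card = m)
    (hTs : ∀ κ ∈ T, e ≤ κ ∧ κ < e + L) (hf : ∀ κ, f κ ≤ M) (hS : ∑ κ ∈ T, f κ ≤ S) :
    ∑ κ ∈ Finset.Ico e (e + L), f κ ≤ (L - m) * M + S := by
  have hsub : T ⊆ Finset.Ico e (e + L) := by
    intro x hx; rw [Finset.mem_Ico]; exact hTs x hx
  rw [← Finset.sum_sdiff hsub]
  have h1 : ∑ κ ∈ Finset.Ico e (e + L) \ T, f κ ≤ (Finset.Ico e (e + L) \ T).card • M :=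
    Finset.sum_le_card_nsmul _ _ _ (fun x _ => hf x)
  have h2 := Finset.card_sdiff_add_card_eq_card hsub
  rw [hT, Nat.card_Ico, Nat.add_sub_cancel_left] at h2
  have h3 : ((Finset.Ico e (e + L) \ T).card : ℝ) = L - m := by
    rw [eq_sub_iff_add_eq]; exact_mod_cast h2
  rw [nsmul_eq_mul, h3] at h1
  linarith

theorem blocks_sum (f : ℕ → ℝ) (L : ℕ) (B : ℝ) (hB : ∀ e, ∑ κ ∈ Finset.Ico e (e + L), f κ ≤ B) (e nb : ℕ) :
    ∑ κ ∈ Finset.Ico e (e + L * nb), f κ ≤ nb * B := by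
  induction nb with
  | zero => simp
  | succ n ih =>
    rw [← Finset.sum_Ico_consecutive f (show e ≤ e + L * n by omega) (show e + L * n ≤ e + L * (n + 1) by
      rw [mul_add]; omega)]
    have := hB (e + L * n)
    rw [show e + L * n + L = e + L * (n + 1) by ring] at this
    push_cast; linarith

theorem ss_bound {p q : ℕ} (hp : 2 ≤ p) (hq : 2 ≤ q) (hcop : Nat.Coprime p q) (hpq : p ≤ q ^ 2)
    (hqp : q ≤ p ^ 2) (m l : ℕ) (hm : 2 ≤ m) (hl : 5 * m ≤ l) (e nb k : ℕ) : ∀ y,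
    (SS p (Finset.Ico e (e + 2 * l * nb)) k (ind q l (q ^ (l - 5 * m))) y : ℝ) ≤
      ((1 - (m : ℝ) / (2 * l)) ^ k + 1 / m) * (2 * l * nb : ℕ) ^ k := by
  have hm0 : (0 : ℝ) < m := by exact_mod_cast (by omega : 0 < m)
  have hl0 : (0 : ℝ) < l := by exact_mod_cast (by omega : 0 < l)
  induction k with
  | zero =>
    intro y
    simp only [SS, pow_zero, mul_one]
    have : (ind q l (q ^ (l - 5 * m)) y : ℝ) ≤ 1 := by exact_mod_cast ind_le_one _ _ _ _
    have h2 : 0 ≤ 1 / (m : ℝ) := by positivity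
    linarith
  | succ k ih =>
    intro y
    simp only [SS]
    push_cast
    set C : ℝ := (1 - (m : ℝ) / (2 * l)) ^ k + 1 / m with hC
    have hb := blocks_sum (fun κ => (SS p (Finset.Ico e (e + 2 * l * nb)) k (ind q l (q ^ (l - 5 * m))) (y + p ^ κ) : ℝ))
      (2 * l) (((2 * l : ℕ) - m) * (C * (2 * l * nb : ℕ) ^ k) + (2 * l * nb : ℕ) ^ k) (by
        intro e'
        obtain ⟨T, hT1, hT2, hT3⟩ := tlem hp hq hcop hpq hqp m l hm hl e'
        refine block_sum _ _ _ e' (2 * l) m T hT1 hT2 (fun κ => ih _) ?_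
        have := sep_sum hT3 (Finset.Ico e (e + 2 * l * nb)) k y
        rw [Nat.card_Ico, Nat.add_sub_cancel_left] at this
        exact_mod_cast this) e nb
    refine hb.trans (le_of_eq ?_)
    rw [hC]
    push_cast
    obtain ⟨u, hu⟩ : ∃ u : ℝ, u = 1 - (m : ℝ) / (2 * l) := ⟨_, rfl⟩
    rw [← hu]
    have hu2 : 2 * (l : ℝ) - m = u * (2 * l) := by rw [hu]; field_simp
    have hu3 : u * (2 * l) / m = 2 * l / m - 1 := by rw [← hu2]; field_simp
    rw [hu2, pow_succ, pow_succ]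
    generalize (2 * (l : ℝ) * nb) ^ k = W
    calc (nb : ℝ) * (u * (2 * l) * ((u ^ k + 1 / m) * W) + W)
        = nb * W * (u ^ k * u * (2 * l) + u * (2 * l) / m + 1) := by ring
      _ = _ := by rw [hu3]; ring

theorem ss_half {p q : ℕ} (hp : 2 ≤ p) (hq : 2 ≤ q) (hcop : Nat.Coprime p q) (hpq : p ≤ q ^ 2)
    (hqp : q ≤ p ^ 2) (m l : ℕ) (hm : 4 ≤ m) (hl : 5 * m ≤ l) (e nb k y : ℕ)
    (hk : (1 - (m : ℝ) / (2 * l)) ^ k ≤ 1 / 4) :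
    2 * SS p (Finset.Ico e (e + 2 * l * nb)) k (ind q l (q ^ (l - 5 * m))) y ≤ (2 * l * nb) ^ k := by
  have h := ss_bound hp hq hcop hpq hqp m l (by omega) hl e nb k y
  have h2 : 1 / (m : ℝ) ≤ 1 / 4 := one_div_le_one_div_of_le (by norm_num) (by exact_mod_cast hm)
  have h3 : ((1 - (m : ℝ) / (2 * l)) ^ k + 1 / m) * (2 * l * nb : ℕ) ^ k ≤ 1 / 2 * (2 * l * nb : ℕ) ^ k :=
    mul_le_mul_of_nonneg_right (by linarith) (by positivity)
  have h4 : (2 : ℝ) * (SS p (Finset.Ico e (e + 2 * l * nb)) k (ind q l (q ^ (l - 5 * m))) y : ℝ) ≤ (2 * l * nb : ℕ) ^ k := by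
    linarith
  exact_mod_cast h4

theorem window {q : ℕ} (hq : 2 ≤ q) (P c c' : ℕ) (h : c ≤ c') :
    digitSum q (P % q ^ c) + 1 ≤ digitSum q (P % q ^ c') + ind q c' (q ^ c) P := by
  have h1 := ds_split hq c (P % q ^ c')
  rw [Nat.mod_mod_of_dvd _ (pow_dvd_pow q h)] at h1
  unfold ind
  split_ifs with h2
  · omega
  · have h3 : 1 ≤ P % q ^ c' / q ^ c := by
      rw [Nat.le_div_iff_mul_le (by positivity)]; omega
    have := ds_pos hq h3
    omega

theorem windows_s {q : ℕ} (hq : 2 ≤ q) (P D m : ℕ) (n : ℕ) :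
    digitSum q (P % q ^ (5 * m * D)) + n ≤ digitSum q (P % q ^ (5 * m * (D + n))) +
      ∑ s ∈ Finset.range n, ind q (5 * m * (D + s + 1)) (q ^ (5 * m * (D + s + 1) - 5 * m)) P := by
  induction n with
  | zero => simp
  | succ n ih =>
    rw [Finset.sum_range_succ]
    have e : 5 * m * (D + n + 1) - 5 * m = 5 * m * (D + n) := by
      rw [mul_add (5 * m) (D + n) 1, mul_one, Nat.add_sub_cancel]
    rw [e]
    have := window hq P (5 * m * (D + n)) (5 * m * (D + n + 1)) (Nat.mul_le_mul_left _ (by omega))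
    rw [← add_assoc D n 1]
    omega

theorem windows_i {q : ℕ} (hq : 2 ≤ q) (P D : ℕ) (I : ℕ) (hI : 2 ≤ I) :
    D * (I - 2) ≤ digitSum q (P % q ^ (5 * 2 ^ I * D)) +
      ∑ i ∈ Finset.Ico 2 I, ∑ s ∈ Finset.range D,
        ind q (5 * 2 ^ i * (D + s + 1)) (q ^ (5 * 2 ^ i * (D + s + 1) - 5 * 2 ^ i)) P := by
  induction I, hI using Nat.le_induction with
  | base => simp
  | succ I hI ih =>
    rw [Finset.sum_Ico_succ_top hI]
    have := windows_s hq P D (2 ^ I) D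
    rw [show 5 * 2 ^ (I + 1) * D = 5 * 2 ^ I * (D + D) by ring, show I + 1 - 2 = (I - 2) + 1 by omega, mul_add, mul_one]
    omega

theorem ac {p q : ℕ} (hp : 2 ≤ p) (hq : 2 ≤ q) (hcop : Nat.Coprime p q) (hpq : p ≤ q ^ 2)
    (hqp : q ≤ p ^ 2) (D : ℕ) (hD : 1 ≤ D) : ∃ k, 1 ≤ k ∧ ∀ e I F, 2 ≤ I →
      ∃ X, SumPow p (Finset.Ico e (e + 10 * 2 ^ I * (2 * D).factorial)) k X ∧
        D * (I - 2) ≤ 2 * digitSum q (F + X) := by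
  have hD0 : (1 : ℝ) ≤ D := by exact_mod_cast hD
  obtain ⟨k, hk⟩ := exists_pow_lt_of_lt_one (show (0:ℝ) < 1 / 4 by norm_num)
    (show 1 - 1 / (20 * (D : ℝ)) < 1 by
      have : 0 < 1 / (20 * (D : ℝ)) := by positivity
      linarith)
  have hk1 : 1 ≤ k := by
    rcases Nat.eq_zero_or_pos k with h | h
    · subst h; norm_num at hk
    · exact h
  refine ⟨k, hk1, ?_⟩
  intro e I F hI
  set M := 10 * 2 ^ I * (2 * D).factorial with hM
  have hMpos : 1 ≤ M := by
    have := Nat.factorial_pos (2 * D)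
    have : 0 < 10 * 2 ^ I * (2 * D).factorial := by positivity
    omega
  have hcard : (Finset.Ico e (e + M)).card = M := by simp
  set φ : ℕ → ℕ := fun P => ∑ i ∈ Finset.Ico 2 I, ∑ s ∈ Finset.range D,
        ind q (5 * 2 ^ i * (D + s + 1)) (q ^ (5 * 2 ^ i * (D + s + 1) - 5 * 2 ^ i)) P with hφ
  have hone : ∀ i ∈ Finset.Ico 2 I, ∀ s ∈ Finset.range D,
      2 * SS p (Finset.Ico e (e + M)) k (ind q (5 * 2 ^ i * (D + s + 1)) (q ^ (5 * 2 ^ i * (D + s + 1) - 5 * 2 ^ i))) F ≤ M ^ k := by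
    intro i hi s hs
    rw [Finset.mem_Ico] at hi
    rw [Finset.mem_range] at hs
    obtain ⟨nb, hnb⟩ : 2 * (5 * 2 ^ i * (D + s + 1)) ∣ M := by
      have h1 : 2 ^ i ∣ 2 ^ I := pow_dvd_pow 2 hi.2.le
      have h2 : D + s + 1 ∣ (2 * D).factorial := Nat.dvd_factorial (by omega) (by omega)
      have := mul_dvd_mul (mul_dvd_mul (dvd_refl 10) h1) h2
      have e1 : 2 * (5 * 2 ^ i * (D + s + 1)) = 10 * 2 ^ i * (D + s + 1) := by ring
      rw [hM, e1]; exact this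
    have h4 : 4 ≤ 2 ^ i := by
      calc 4 = 2 ^ 2 := by norm_num
        _ ≤ 2 ^ i := Nat.pow_le_pow_right (by omega) hi.1
    have := ss_half hp hq hcop hpq hqp (2 ^ i) (5 * 2 ^ i * (D + s + 1)) h4
      (Nat.le_mul_of_pos_right _ (by omega)) e nb k F (by
        have hx : (((2 ^ i : ℕ) : ℝ) / (2 * ((5 * 2 ^ i * (D + s + 1) : ℕ) : ℝ))) = 1 / (10 * (D + s + 1)) := by
          push_cast; field_simp; norm_num
        rw [hx]
        have hs' : (s : ℝ) + 1 ≤ D := by exact_mod_cast hs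
        have hs0 : (0 : ℝ) ≤ s := by positivity
        have y1 : 1 / (20 * (D : ℝ)) ≤ 1 / (10 * (D + s + 1)) :=
          one_div_le_one_div_of_le (by positivity) (by linarith)
        have y2 : 1 / (10 * ((D : ℝ) + s + 1)) ≤ 1 := by
          rw [div_le_one (by positivity)]; linarith
        exact (pow_le_pow_left₀ (by linarith) (by linarith) k).trans hk.le)
    rw [← hnb] at this
    exact this
  have hφS : SS p (Finset.Ico e (e + M)) k φ F = ∑ i ∈ Finset.Ico 2 I, ∑ s ∈ Finset.range D,
      SS p (Finset.Ico e (e + M)) k (ind q (5 * 2 ^ i * (D + s + 1)) (q ^ (5 * 2 ^ i * (D + s + 1) - 5 * 2 ^ i))) F := by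
    rw [hφ, SS_sum]
    apply Finset.sum_congr rfl
    intro i _
    rw [SS_sum]
  obtain ⟨X, hX, h5⟩ := SS_exists p (Finset.Ico e (e + M)) (by omega) φ (D * (I - 2)) 2 k F (by
    rw [hφS, hcard, Finset.mul_sum]
    have : ∀ i ∈ Finset.Ico 2 I, 2 * ∑ s ∈ Finset.range D,
      SS p (Finset.Ico e (e + M)) k (ind q (5 * 2 ^ i * (D + s + 1)) (q ^ (5 * 2 ^ i * (D + s + 1) - 5 * 2 ^ i))) F ≤ D * M ^ k := by
      intro i hi
      rw [Finset.mul_sum]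
      have := Finset.sum_le_card_nsmul (Finset.range D) _ _ (hone i hi)
      simpa using this
    have := Finset.sum_le_card_nsmul (Finset.Ico 2 I) _ _ this
    rw [Nat.card_Ico, smul_eq_mul] at this
    calc _ ≤ _ := this
      _ = _ := by ring)
  refine ⟨X, hX, ?_⟩
  have h6 := windows_i hq (F + X) D I hI
  have h7 := ds_split hq (5 * 2 ^ I * D) (F + X)
  change 2 * (∑ i ∈ Finset.Ico 2 I, ∑ s ∈ Finset.range D,
        ind q (5 * 2 ^ i * (D + s + 1)) (q ^ (5 * 2 ^ i * (D + s + 1) - 5 * 2 ^ i)) (F + X)) ≤ D * (I - 2) at h5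
  omega


theorem ds_sum_pow {p : ℕ} (hp : 2 ≤ p) (S : Finset ℕ) : digitSum p (∑ π ∈ S, p ^ π) ≤ S.card := by
  classical
  induction S using Finset.induction_on with
  | empty => simp [ds_zero]
  | insert x S hx ih =>
    rw [Finset.sum_insert hx, Finset.card_insert_of_notMem hx, add_comm]
    have := ds_add_pow hp (∑ π ∈ S, p ^ π) x
    omega

theorem sum_pow_mod {p : ℕ} (hp : 2 ≤ p) (S : Finset ℕ) (κ : ℕ) :
    (∑ π ∈ S, p ^ π) % p ^ κ = ∑ π ∈ S.filter (· < κ), p ^ π := by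
  rw [← Finset.sum_filter_add_sum_filter_not S (· < κ)]
  have h1 : p ^ κ ∣ ∑ π ∈ S.filter (fun x => ¬ x < κ), p ^ π := by
    apply Finset.dvd_sum
    intro x hx
    rw [Finset.mem_filter] at hx
    exact pow_dvd_pow p (by omega)
  have h2 : ∑ π ∈ S.filter (· < κ), p ^ π < p ^ κ := by
    apply Nat.geomSum_lt hp
    intro x hx
    exact (Finset.mem_filter.1 hx).2
  obtain ⟨c, hc⟩ := h1
  rw [hc, Nat.add_mul_mod_self_left, Nat.mod_eq_of_lt h2]

theorem construct {p : ℕ} (hp : 2 ≤ p) (G J : ℕ) (hG : 1 ≤ G) :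
    ∃ F, F < p ^ (G * 2 ^ J) ∧ digitSum p F ≤ G * J ∧ ∀ κ, 4 * G + 1 ≤ κ → κ ≤ G * 2 ^ J →
      ∃ j, 4 ≤ j ∧ G * j ≤ κ ∧ p ^ (κ - j) ≤ F % p ^ κ ∧ F % p ^ κ + p ^ (κ - j) ≤ p ^ κ := by
  classical
  obtain ⟨S, hS⟩ : ∃ S : Finset ℕ, S = ((Finset.Ico 1 J) ×ˢ (Finset.range G)).image
    (fun x => 2 ^ x.1 * (G + x.2)) := ⟨_, rfl⟩
  have hmem : ∀ π, π ∈ S ↔ ∃ i s, 1 ≤ i ∧ i < J ∧ s < G ∧ 2 ^ i * (G + s) = π := by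
    intro π
    rw [hS]
    simp only [Finset.mem_image, Finset.mem_product, Finset.mem_Ico, Finset.mem_range, Prod.exists]
    constructor
    · rintro ⟨i, s, ⟨⟨h1, h2⟩, h3⟩, h4⟩; exact ⟨i, s, h1, h2, h3, h4⟩
    · rintro ⟨i, s, h1, h2, h3, h4⟩; exact ⟨i, s, ⟨⟨h1, h2⟩, h3⟩, h4⟩
  have heven : ∀ π ∈ S, π % 2 = 0 := by
    intro π hπ
    obtain ⟨i, s, h1, h2, h3, rfl⟩ := (hmem π).1 hπ
    have : 2 ∣ 2 ^ i := dvd_pow_self 2 (by omega)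
    exact Nat.mod_eq_zero_of_dvd (this.mul_right _)
  refine ⟨∑ π ∈ S, p ^ π, ?_, ?_, ?_⟩
  · apply Nat.geomSum_lt hp
    intro π hπ
    obtain ⟨i, s, h1, h2, h3, rfl⟩ := (hmem π).1 hπ
    calc 2 ^ i * (G + s) < 2 ^ i * (G * 2) := Nat.mul_lt_mul_of_pos_left (by omega) (by positivity)
      _ = G * 2 ^ (i + 1) := by ring
      _ ≤ _ := Nat.mul_le_mul_left _ (Nat.pow_le_pow_right (by omega) (by omega))
  · refine (ds_sum_pow hp S).trans ?_
    rw [hS]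
    refine Finset.card_image_le.trans ?_
    rw [Finset.card_product, Nat.card_Ico, Finset.card_range, mul_comm]
    exact Nat.mul_le_mul_left _ (by omega)
  intro κ hκ1 hκ2
  rw [sum_pow_mod hp]
  obtain ⟨i, hi⟩ : ∃ i, i = Nat.log 2 ((κ - 1) / G) := ⟨_, rfl⟩
  have hq4 : 4 ≤ (κ - 1) / G := by
    rw [Nat.le_div_iff_mul_le (by omega)]; omega
  have hi1 : 2 ^ i ≤ (κ - 1) / G := by rw [hi]; exact Nat.pow_log_le_self 2 (by omega)
  have hi2 : (κ - 1) / G < 2 ^ (i + 1) := by rw [hi]; exact Nat.lt_pow_succ_log_self (by omega) _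
  rw [Nat.le_div_iff_mul_le (by omega)] at hi1
  rw [Nat.div_lt_iff_lt_mul (by omega)] at hi2
  have hi2' : 2 ≤ i := by
    rw [hi]; apply Nat.le_log_of_pow_le (by omega); norm_num; exact hq4
  have hiJ : i < J := by
    have : 2 ^ i * G < 2 ^ J * G := by rw [mul_comm (2 ^ J)]; omega
    have := Nat.lt_of_mul_lt_mul_right this
    exact (Nat.pow_lt_pow_iff_right (by omega)).1 this
  have hj4 : 4 ≤ 2 ^ i := by
    calc 4 = 2 ^ 2 := by norm_num
      _ ≤ 2 ^ i := Nat.pow_le_pow_right (by omega) hi2'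
  refine ⟨2 ^ i, hj4, by rw [mul_comm]; omega, ?_, ?_⟩
  · obtain ⟨w, hw⟩ : ∃ w, w = (κ - 1) / 2 ^ i := ⟨_, rfl⟩
    have hw1 : G ≤ w := by
      rw [hw, Nat.le_div_iff_mul_le (by positivity), mul_comm]; exact hi1
    have hw2 : w < 2 * G := by
      rw [hw, Nat.div_lt_iff_lt_mul (by positivity)]
      calc κ - 1 < 2 ^ (i + 1) * G := hi2
        _ = _ := by ring
    have hw3 : 2 ^ i * w ≤ κ - 1 := by rw [hw]; exact Nat.mul_div_le _ _
    have hw4 : κ - 1 < 2 ^ i * w + 2 ^ i := by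
      have := Nat.lt_mul_div_succ (κ - 1) (show 0 < 2 ^ i by positivity)
      rw [hw]; rw [mul_add, mul_one] at this; exact this
    have hin : 2 ^ i * w ∈ S.filter (· < κ) := by
      rw [Finset.mem_filter]
      refine ⟨(hmem _).2 ⟨i, w - G, by omega, hiJ, by omega, ?_⟩, by omega⟩
      congr 1; omega
    calc p ^ (κ - 2 ^ i) ≤ p ^ (2 ^ i * w) := Nat.pow_le_pow_right (by omega) (by omega)
      _ ≤ _ := Finset.single_le_sum (f := fun π => p ^ π) (fun _ _ => Nat.zero_le _) hin
  · obtain ⟨ν, hν1, hν2, hν3⟩ : ∃ ν, κ - 2 ≤ ν ∧ ν < κ ∧ ν % 2 = 1 := by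
      rcases Nat.mod_two_eq_zero_or_one κ with h | h
      · exact ⟨κ - 1, by omega, by omega, by omega⟩
      · exact ⟨κ - 2, by omega, by omega, by omega⟩
    have hnot : ν ∉ S.filter (· < κ) := by
      intro h
      have := heven ν (Finset.mem_filter.1 h).1
      omega
    have hlt : ∑ π ∈ insert ν (S.filter (· < κ)), p ^ π < p ^ κ := by
      apply Nat.geomSum_lt hp
      intro x hx
      rcases Finset.mem_insert.1 hx with h | h
      · omega
      · exact (Finset.mem_filter.1 h).2
    rw [Finset.sum_insert hnot] at hlt
    have : p ^ (κ - 2 ^ i) ≤ p ^ ν := Nat.pow_le_pow_right (by omega) (by omega)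
    omega

theorem sumPow_facts {p : ℕ} (hp : 2 ≤ p) (e M : ℕ) (k : ℕ) : ∀ X, SumPow p (Finset.Ico e M) k X →
    p ^ e ∣ X ∧ (1 ≤ k → p ^ e ≤ X) ∧ X ≤ k * p ^ M ∧ ∀ F, digitSum p (F + X) ≤ digitSum p F + k := by
  induction k with
  | zero =>
    intro X hX
    change X = 0 at hX
    subst hX
    refine ⟨by simp, by omega, by simp, by simp⟩
  | succ k ih =>
    rintro X ⟨κ, hκ, X', hX', rfl⟩
    obtain ⟨h1, h2, h3, h4⟩ := ih X' hX'
    rw [Finset.mem_Ico] at hκ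
    refine ⟨(pow_dvd_pow p hκ.1).add h1, ?_, ?_, ?_⟩
    · intro _
      have : p ^ e ≤ p ^ κ := Nat.pow_le_pow_right (by omega) hκ.1
      omega
    · have : p ^ κ ≤ p ^ M := Nat.pow_le_pow_right (by omega) hκ.2.le
      rw [add_mul]; omega
    · intro F
      have := h4 (F + p ^ κ)
      have h5 := ds_add_pow hp F κ
      rw [← add_assoc]; omega


theorem crossing (f : ℕ → ℤ) (B : ℤ) (hB0 : 0 ≤ B) (u v : ℕ) (huv : u ≤ v) (hu : 0 ≤ f u) (hv : f v ≤ 0)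
    (hstep : ∀ x, f x - B ≤ f (x + 1)) : ∃ x, u ≤ x ∧ x ≤ v ∧ |f x| ≤ B := by
  induction v, huv using Nat.le_induction with
  | base => exact ⟨u, le_rfl, le_rfl, by rw [le_antisymm hv hu]; simpa using hB0⟩
  | succ v huv ih =>
    by_cases h : f v ≤ 0
    · obtain ⟨x, h1, h2, h3⟩ := ih h
      exact ⟨x, h1, by omega, h3⟩
    · refine ⟨v, huv, by omega, ?_⟩
      have := hstep v
      rw [abs_of_nonneg (by omega)]; omega

theorem ds_div_sub {q : ℕ} (hq : 2 ≤ q) (P l d : ℕ) :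
    (digitSum q (P / q ^ l) : ℤ) ≤ digitSum q (P / q ^ (l + d)) + (q - 1) * d := by
  rw [pow_add, ← Nat.div_div_eq_div_mul]
  refine (ds_sub_bound hq d (P / q ^ l / q ^ d) (P / q ^ l) (Nat.div_mul_le_self _ _) ?_).2
  rw [mul_comm]
  exact Nat.lt_mul_div_succ _ (by positivity)

/-- The balance function. -/
def Psi (p q a b P κ : ℕ) : ℤ :=
  2 * ((b : ℤ) * digitSum q (P / q ^ (Nat.log q (p ^ κ))) - a * digitSum p (P / p ^ κ))
        - (a * (p - 1) * κ - b * (q - 1) * (Nat.log q (p ^ κ) : ℕ))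

theorem psi_step {p q : ℕ} (a b : ℕ) (hp : 2 ≤ p) (hq : 2 ≤ q) (hpq : p ≤ q ^ 2) (P κ : ℕ) :
    Psi p q a b P κ - (4 * b * q + a * p : ℕ) ≤ Psi p q a b P (κ + 1) := by
  unfold Psi
  obtain ⟨l, hl⟩ : ∃ l, l = Nat.log q (p ^ κ) := ⟨_, rfl⟩
  obtain ⟨l', hl'⟩ : ∃ l, l = Nat.log q (p ^ (κ + 1)) := ⟨_, rfl⟩
  rw [← hl, ← hl']
  have h1 : l ≤ l' := by
    rw [hl, hl']; exact Nat.log_mono_right (Nat.pow_le_pow_right (by omega) (by omega))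
  have h2 : l' ≤ l + 2 := by
    have : q ^ l' < q ^ (l + 1 + 2) := by
      calc q ^ l' ≤ p ^ (κ + 1) := by rw [hl']; exact Nat.pow_log_le_self q (by positivity)
        _ = p ^ κ * p := pow_succ _ _
        _ ≤ p ^ κ * q ^ 2 := Nat.mul_le_mul_left _ hpq
        _ < q ^ (l + 1) * q ^ 2 := by
            apply Nat.mul_lt_mul_of_pos_right _ (by positivity)
            rw [hl]; exact Nat.lt_pow_succ_log_self (by omega) _
        _ = _ := by rw [← pow_add]
    have := (Nat.pow_lt_pow_iff_right (by omega)).1 this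
    omega
  obtain ⟨d, rfl⟩ := Nat.exists_eq_add_of_le h1
  have g1 := ds_div_sub hq P l d
  have g2 : digitSum p (P / p ^ (κ + 1)) ≤ digitSum p (P / p ^ κ) := by
    rw [pow_add, ← Nat.div_div_eq_div_mul]; exact ds_div_le hp _ 1
  have g2' : (digitSum p (P / p ^ (κ + 1)) : ℤ) ≤ digitSum p (P / p ^ κ) := by exact_mod_cast g2
  have hd : (d : ℤ) ≤ 2 := by exact_mod_cast (by omega : d ≤ 2)
  have hq' : (2 : ℤ) ≤ q := by exact_mod_cast hq
  have hp' : (2 : ℤ) ≤ p := by exact_mod_cast hp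
  have ha0 : (0 : ℤ) ≤ a := by positivity
  have hb0 : (0 : ℤ) ≤ b := by positivity
  have k1 := mul_le_mul_of_nonneg_left g1 hb0
  have k2 := mul_le_mul_of_nonneg_left g2' ha0
  have k3 : (b : ℤ) * ((q - 1) * d) ≤ 2 * (b * q) := by
    calc (b : ℤ) * ((q - 1) * d) ≤ b * (q * 2) := by
          apply mul_le_mul_of_nonneg_left _ hb0
          apply mul_le_mul <;> linarith
      _ = _ := by ring
  have k4 : 0 ≤ (b : ℤ) * ((q - 1) * d) := mul_nonneg hb0 (mul_nonneg (by linarith) (by positivity))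
  push_cast
  rw [mul_add] at k1
  have e1 : (a : ℤ) * (p - 1) * (κ + 1) = a * (p - 1) * κ + a * p - a := by ring
  have e2 : (b : ℤ) * (q - 1) * (l + d) = b * (q - 1) * l + b * ((q - 1) * d) := by ring
  rw [e1, e2]
  linarith

theorem gen {p q a b : ℕ} (hp : 2 ≤ p) (hq : 2 ≤ q) (hcop : Nat.Coprime p q) (hpq : p ≤ q ^ 2)
    (hqp : q ≤ p ^ 2) (ha : 1 ≤ a) (hb : 1 ≤ b) (hGad : Gad p q a b)
    (Hc : ∃ C : ℕ, ∀ κ l : ℕ, q ^ l ≤ p ^ κ → C * (b * (q - 1) * l) + κ ≤ C * (a * (p - 1) * κ))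
    (N0 : ℕ) : ∃ N, N0 < N ∧ ff p q a b N = 0 := by
  obtain ⟨G, κ00, hG1, hil⟩ := il hp hq hcop hpq hqp ha hGad
  obtain ⟨C, hC⟩ := Hc
  obtain ⟨D, hD⟩ : ∃ D, D = 2 * a * G + 1 := ⟨_, rfl⟩
  obtain ⟨k, hk1, hac⟩ := ac hp hq hcop hpq hqp D (by omega)
  obtain ⟨B, hB⟩ : ∃ B, B = 4 * b * q + a * p := ⟨_, rfl⟩
  obtain ⟨κ1, hκ1⟩ : ∃ κ1, κ1 = 32 * B + κ00 + (4 * G + 1) + (N0 + 1) := ⟨_, rfl⟩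
  obtain ⟨l1, hl1⟩ : ∃ l1, l1 = Nat.log q (p ^ κ1) := ⟨_, rfl⟩
  obtain ⟨f, hf⟩ : ∃ f, f = (2 * D).factorial := ⟨_, rfl⟩
  obtain ⟨t, ht⟩ : ∃ t, t = C * (2 * (b * (q - 1) * (20 * f + k + 1))) := ⟨_, rfl⟩
  obtain ⟨I, hI⟩ : ∃ I, I = 2 * D + 2 * (b * ((q - 1) * l1)) + 2 * a * G * t + 2 * a * k + a * (p - 1) * κ1 + κ1 + 2 := ⟨_, rfl⟩
  obtain ⟨e, he⟩ : ∃ e, e = G * 2 ^ (I + t) := ⟨_, rfl⟩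
  obtain ⟨F, hF1, hF2, hF3⟩ := construct hp G (I + t) hG1
  rw [← he] at hF1 hF3
  obtain ⟨X, hX, hX2⟩ := hac e I F (by omega)
  rw [← hf] at hX
  obtain ⟨w, hw⟩ : ∃ w, w = 10 * 2 ^ I * f := ⟨_, rfl⟩
  rw [← hw] at hX
  obtain ⟨x1, x2, x3, x4⟩ := sumPow_facts hp e _ k X hX
  have x2 := x2 hk1
  have x4 := x4 F
  obtain ⟨P, hP⟩ : ∃ P, P = F + X := ⟨_, rfl⟩
  rw [← hP] at hX2 x4
  have hκe : κ1 ≤ e := by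
    have h1 : I + t < 2 ^ (I + t) := Nat.lt_two_pow_self
    have h2 : 2 ^ (I + t) ≤ e := by rw [he]; exact Nat.le_mul_of_pos_left _ (by omega)
    have : κ1 ≤ I := by rw [hI]; omega
    omega
  have hq1 : ((q - 1 : ℕ) : ℤ) = q - 1 := by rw [Nat.cast_sub (by omega)]; simp
  have hp1 : ((p - 1 : ℕ) : ℤ) = p - 1 := by rw [Nat.cast_sub (by omega)]; simp
  have ha0 : (0 : ℤ) ≤ a := by positivity
  have hb0 : (0 : ℤ) ≤ b := by positivity
  -- start
  have hstart : 0 ≤ Psi p q a b P κ1 := by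
    unfold Psi
    rw [← hl1]
    have s1 := ds_div_sub hq P 0 l1
    simp only [pow_zero, Nat.div_one, zero_add] at s1
    have s2 : digitSum p (P / p ^ κ1) ≤ G * (I + t) + k := by
      have := ds_div_le hp P κ1
      omega
    have s2' : (digitSum p (P / p ^ κ1) : ℤ) ≤ G * (I + t) + k := by exact_mod_cast s2
    have s3 : D * I ≤ 2 * digitSum q P + 2 * D := by
      have : D * (I - 2) + D * 2 = D * I := by rw [← mul_add]; congr 1; omega
      omega
    have s3' : (D : ℤ) * I ≤ 2 * digitSum q P + 2 * D := by exact_mod_cast s3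
    have hD' : (D : ℤ) = 2 * a * G + 1 := by rw [hD]; push_cast; ring
    have hI' : (I : ℤ) = 2 * D + 2 * (b * ((q - 1) * l1)) + 2 * a * G * t + 2 * a * k + a * (p - 1) * κ1 + κ1 + 2 := by
      rw [hI]; push_cast [hq1, hp1]; ring
    have k1 := mul_le_mul_of_nonneg_left s1 hb0
    have k2 := mul_le_mul_of_nonneg_left s2' ha0
    have k3 : (D : ℤ) * I - 2 * D ≤ b * (2 * digitSum q P) := by
      have hb1 : (1 : ℤ) ≤ b := by exact_mod_cast hb
      have h0 : (0 : ℤ) ≤ 2 * digitSum q P := by positivity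
      have := le_mul_of_one_le_left h0 hb1
      linarith
    have k4 : (D : ℤ) * I = 2 * a * G * I + I := by rw [hD']; ring
    have k5 : 0 ≤ (b : ℤ) * (q - 1) * l1 := by rw [← hq1]; positivity
    have k6 : (0 : ℤ) ≤ κ1 := by positivity
    generalize (digitSum q P : ℤ) = z1 at *
    generalize (digitSum q (P / q ^ l1) : ℤ) = z2 at *
    generalize (digitSum p (P / p ^ κ1) : ℤ) = z3 at *
    have k7 : (a : ℤ) * (G * (I + t) + k) = a * G * I + a * G * t + a * k := by ring
    rw [k7] at k2
    rw [mul_add] at k1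
    linarith
  have hend : Psi p q a b P e ≤ 0 := by
    unfold Psi
    obtain ⟨l, hl⟩ : ∃ l, l = Nat.log q (p ^ e) := ⟨_, rfl⟩
    rw [← hl]
    have y1 : q ^ l ≤ p ^ e := by rw [hl]; exact Nat.pow_log_le_self q (by positivity)
    have y2 : p ^ e < q ^ (l + 1) := by rw [hl]; exact Nat.lt_pow_succ_log_self (by omega) _
    have y3 : P < q ^ l * q ^ (1 + 2 * w + k) := by
      have z1 : p ^ w ≤ q ^ (2 * w) := by rw [pow_mul]; exact Nat.pow_le_pow_left hpq _
      have z2 : k + 1 ≤ q ^ k := by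
        have : k < 2 ^ k := Nat.lt_two_pow_self
        have : 2 ^ k ≤ q ^ k := Nat.pow_le_pow_left hq _
        omega
      have z3 : p ^ e ≤ p ^ (e + w) := Nat.pow_le_pow_right (by omega) (by omega)
      calc P ≤ (k + 1) * p ^ (e + w) := by rw [hP, add_mul, one_mul]; omega
        _ = (k + 1) * p ^ w * p ^ e := by rw [pow_add]; ring
        _ < (k + 1) * p ^ w * q ^ (l + 1) := Nat.mul_lt_mul_of_pos_left y2 (by positivity)
        _ ≤ q ^ k * q ^ (2 * w) * q ^ (l + 1) := Nat.mul_le_mul_right _ (Nat.mul_le_mul z2 z1)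
        _ = _ := by rw [← pow_add, ← pow_add, ← pow_add]; congr 1; ring
    have y4 : digitSum q (P / q ^ l) ≤ (q - 1) * (1 + 2 * w + k) :=
      ds_le hq _ (Nat.div_lt_of_lt_mul y3)
    have y5 := hC e l y1
    have y6 : C * (2 * (b * digitSum q (P / q ^ l))) ≤ e := by
      have v1 : 1 + 2 * w + k ≤ (20 * f + k + 1) * 2 ^ I := by
        have : 1 ≤ 2 ^ I := Nat.one_le_two_pow
        have v2 : (k + 1) * 1 ≤ (k + 1) * 2 ^ I := Nat.mul_le_mul_left _ this
        calc 1 + 2 * w + k = 20 * f * 2 ^ I + (k + 1) * 1 := by rw [hw]; ring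
          _ ≤ 20 * f * 2 ^ I + (k + 1) * 2 ^ I := by omega
          _ = _ := by ring
      calc C * (2 * (b * digitSum q (P / q ^ l))) ≤ C * (2 * (b * ((q - 1) * ((20 * f + k + 1) * 2 ^ I)))) := by
            gcongr
            exact y4.trans (Nat.mul_le_mul_left _ v1)
        _ = t * 2 ^ I := by rw [ht]; ring
        _ ≤ 2 ^ t * 2 ^ I := Nat.mul_le_mul_right _ Nat.lt_two_pow_self.le
        _ = 2 ^ (I + t) := by rw [← pow_add]; congr 1; ring
        _ ≤ e := by rw [he]; exact Nat.le_mul_of_pos_left _ (by omega)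
    have y7 : C * (2 * (b * digitSum q (P / q ^ l)) + b * (q - 1) * l) ≤ C * (a * (p - 1) * e) := by
      rw [mul_add]; omega
    have hC1 : 0 < C := by
      rcases Nat.eq_zero_or_pos C with h | h
      · subst h; have := hC 1 0 (by simpa using (by omega : 1 ≤ p)); omega
      · exact h
    have y8 := Nat.le_of_mul_le_mul_left y7 hC1
    have y9 : 2 * ((b : ℤ) * digitSum q (P / q ^ l)) + b * (q - 1) * l ≤ a * (p - 1) * e := by
      rw [← hq1, ← hp1]; exact_mod_cast y8
    have y10 : 0 ≤ (a : ℤ) * digitSum p (P / p ^ e) := by positivity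
    linarith
  obtain ⟨κ, c1, c2, c3⟩ := crossing (Psi p q a b P) (B : ℤ) (by positivity) κ1 e hκe hstart hend
    (fun x => by rw [hB]; exact psi_step a b hp hq hpq P x)
  obtain ⟨j, j1, j2, j3, j4⟩ := hF3 κ (by omega) c2
  have hmod : P % p ^ κ = F % p ^ κ := by
    obtain ⟨c, hc⟩ := (pow_dvd_pow p c2).trans x1
    rw [hP, hc, Nat.add_mul_mod_self_left]
  rw [← hmod] at j3 j4
  obtain ⟨N, n1, n2⟩ := hil P κ j (by omega) j1 j2 j3 j4 (by
    unfold Psi at c3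
    have : (32 : ℤ) * B ≤ κ := by exact_mod_cast (by omega : 32 * B ≤ κ)
    linarith)
  refine ⟨N, ?_, n2⟩
  have hPe : p ^ κ ≤ P := by
    have : p ^ κ ≤ p ^ e := Nat.pow_le_pow_right (by omega) c2
    omega
  have h1 : 1 ≤ P / p ^ κ := by
    rw [Nat.le_div_iff_mul_le (by positivity)]; omega
  have h2 : p ^ κ ≤ P / p ^ κ * p ^ κ := Nat.le_mul_of_pos_left _ h1
  have h3 : κ < p ^ κ := Nat.lt_pow_self (by omega)
  omega


theorem exists_pow_gap (x y c : ℕ) (hx : 1 ≤ x) (hxy : x < y) : ∃ M, c * x ^ M ≤ y ^ M := by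
  have hx0 : (0 : ℝ) < x := by exact_mod_cast hx
  have h1 : (1 : ℝ) < (y : ℝ) / x := by rw [one_lt_div hx0]; exact_mod_cast hxy
  obtain ⟨M, hM⟩ := pow_unbounded_of_one_lt (c : ℝ) h1
  refine ⟨M, ?_⟩
  rw [div_pow, lt_div_iff₀ (by positivity)] at hM
  exact_mod_cast hM.le

theorem hc_of_lt {p q : ℕ} (hp : 2 ≤ p) (hq : 2 ≤ q) (α β : ℕ) (h : p ^ β < q ^ α) :
    ∃ C : ℕ, ∀ κ l : ℕ, q ^ l ≤ p ^ κ → C * (β * l) + κ ≤ C * (α * κ) := by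
  obtain ⟨M, hM⟩ := exists_pow_gap (p ^ β) (q ^ α) q (Nat.one_le_pow _ _ (by omega)) h
  refine ⟨M, ?_⟩
  intro κ l hl
  have : q ^ (M * (β * l) + κ) ≤ q ^ (M * (α * κ)) := by
    calc q ^ (M * (β * l) + κ) = (q ^ l) ^ (β * M) * q ^ κ := by
          rw [← pow_mul, ← pow_add]; congr 1; ring
      _ ≤ (p ^ κ) ^ (β * M) * q ^ κ := Nat.mul_le_mul_right _ (Nat.pow_le_pow_left hl _)
      _ = (q * (p ^ β) ^ M) ^ κ := by rw [mul_pow, ← pow_mul, ← pow_mul, ← pow_mul, mul_comm]; congr 2; ring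
      _ ≤ ((q ^ α) ^ M) ^ κ := Nat.pow_le_pow_left hM _
      _ = _ := by rw [← pow_mul, ← pow_mul]; congr 1; ring
  exact (Nat.pow_le_pow_iff_right (by omega)).1 this

theorem stmt2 (a b : ℕ) (ha : 1 ≤ a) (hb : 1 ≤ b) :
    ∀ N : ℕ, ∃ n : ℕ, N < n ∧ a * digitSum 2 n = b * digitSum 3 n := by
  intro N
  have hne : 2 ^ (2 * b) ≠ 3 ^ a := by
    intro h
    have h1 : 2 ∣ 3 ^ a := by rw [← h]; exact dvd_pow_self 2 (by omega)
    have h2 := Nat.prime_two.dvd_of_dvd_pow h1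
    omega
  rcases lt_or_gt_of_ne hne with h | h
  · obtain ⟨n, h1, h2⟩ := gen (p := 2) (q := 3) (by norm_num) (by norm_num) (by norm_num) (by norm_num)
      (by norm_num) ha hb (gad23 a b ha hb) (by
        have := hc_of_lt (p := 2) (q := 3) (by norm_num) (by norm_num) (a * (2 - 1)) (b * (3 - 1))
          (by simpa [mul_comm] using h)
        exact this) N
    refine ⟨n, h1, ?_⟩
    unfold ff at h2
    exact_mod_cast sub_eq_zero.1 h2
  · obtain ⟨n, h1, h2⟩ := gen (p := 3) (q := 2) (by norm_num) (by norm_num) (by norm_num) (by norm_num)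
      (by norm_num) hb ha (gad32 a b ha hb) (by
        have := hc_of_lt (p := 3) (q := 2) (by norm_num) (by norm_num) (b * (3 - 1)) (a * (2 - 1))
          (by simpa [mul_comm] using h)
        exact this) N
    refine ⟨n, h1, ?_⟩
    unfold ff at h2
    exact_mod_cast (sub_eq_zero.1 h2).symm
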